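/- arXiv:2505.00943 — 3 statements merged into one kernel-verified Lean document; each statement's English description precedes it below -/
import Mathlib

section
/- (Metric Helly theorem) Let X be a convex metric space of topological dimension at most d, and let C₁, …, C_m be closed convex subsets of X. If every subfamily of at most d+1 of the sets has non-empty intersection, then C₁ ∩ ⋯ ∩ C_m is non-empty. -/
/-- A geodesic segment from `x` to `y`, parameterized proportionally to arc length on `[0,1]`. -/
def IsGeodesicSeg {X : Type*} [MetricSpace X] (x y : X) (γ : ℝ → X) : Prop :=
  γ 0 = x ∧ γ 1 = y ∧
    ∀ s ∈ Set.Icc (0:ℝ) 1, ∀ t ∈ Set.Icc (0:ℝ) 1, dist (γ s) (γ t) = |s - t| * dist x y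

/-- A CAT(0) space: a geodesic metric space satisfying the CN (Bruhat–Tits comparison)
inequality, which for geodesic spaces is equivalent to the CAT(0) comparison-triangle
condition. -/
class CAT0Space (X : Type*) [MetricSpace X] : Prop where
  geodesic : ∀ x y : X, ∃ γ : ℝ → X, IsGeodesicSeg x y γ
  cn : ∀ x y z m : X, dist y m = dist y z / 2 → dist z m = dist y z / 2 →
    dist x m ^ 2 ≤ (dist x y ^ 2 + dist x z ^ 2) / 2 - dist y z ^ 2 / 4

/-- A subset of a metric space is (geodesically) convex if it contains every geodesic
segment between any two of its points. -/
def GeodConvex {X : Type*} [MetricSpace X] (C : Set X) : Prop :=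
  ∀ x ∈ C, ∀ y ∈ C, ∀ γ : ℝ → X, IsGeodesicSeg x y γ → ∀ t ∈ Set.Icc (0:ℝ) 1, γ t ∈ C

/-- A convex metric space in the sense of Busemann: a uniquely geodesic space in which the
distance between any two geodesics (parameterized proportionally to arc length) is a convex
function. -/
class ConvexMetricSpace (X : Type*) [MetricSpace X] : Prop where
  geodesic : ∀ x y : X, ∃ γ : ℝ → X, IsGeodesicSeg x y γ
  unique_geodesic : ∀ (x y : X) (γ₁ γ₂ : ℝ → X), IsGeodesicSeg x y γ₁ → IsGeodesicSeg x y γ₂ →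
    ∀ t ∈ Set.Icc (0:ℝ) 1, γ₁ t = γ₂ t
  convex : ∀ (x₁ y₁ x₂ y₂ : X) (γ₁ γ₂ : ℝ → X), IsGeodesicSeg x₁ y₁ γ₁ →
    IsGeodesicSeg x₂ y₂ γ₂ →
    ConvexOn ℝ (Set.Icc (0:ℝ) 1) (fun t => dist (γ₁ t) (γ₂ t))

/-- Topological covering dimension of `X` is at most `d`: every open cover has an open
refinement in which each point lies in at most `d + 1` sets. -/
def CoveringDimLE (X : Type*) [TopologicalSpace X] (d : ℕ) : Prop :=
  ∀ (ι : Type) (U : ι → Set X), (∀ i, IsOpen (U i)) → (⋃ i, U i) = Set.univ →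
    ∃ (κ : Type) (V : κ → Set X), (∀ j, IsOpen (V j)) ∧ (⋃ j, V j) = Set.univ ∧
      (∀ j, ∃ i, V j ⊆ U i) ∧
      ∀ x : X, {j | x ∈ V j}.Finite ∧ {j | x ∈ V j}.ncard ≤ d + 1

section HellyAux

open Set Metric MeasureTheory Topology

/-- Interpolation: the determinant of `1 + t A` is a polynomial of degree at most `n` in `t`. -/
lemma det_interp {n : ℕ} (v : Fin (n+1) → ℝ) (hv : Function.Injective v) :
    ∃ w : Fin (n+1) → ℝ, ∑ i, w i = 1 ∧
      ∀ A : EuclideanSpace ℝ (Fin n) →L[ℝ] EuclideanSpace ℝ (Fin n),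
        (1 + A).det = ∑ i, w i * (1 + v i • A).det := by
  refine ⟨fun i => (Lagrange.basis Finset.univ v i).eval 1, ?_, ?_⟩
  · rw [← Polynomial.eval_finsetSum, Lagrange.sum_basis hv.injOn ⟨0, Finset.mem_univ _⟩]
    simp
  · intro A
    let b := (EuclideanSpace.basisFun (Fin n) ℝ).toBasis
    let M := LinearMap.toMatrix b b (A : EuclideanSpace ℝ (Fin n) →ₗ[ℝ] EuclideanSpace ℝ (Fin n))
    let p : Polynomial ℝ := Matrix.det ((Polynomial.X : Polynomial ℝ) • M.map Polynomial.C +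
      (1 : Matrix (Fin n) (Fin n) ℝ).map Polynomial.C)
    have hp : ∀ t : ℝ, p.eval t = (1 + t • A).det := by
      intro t
      have e1 : p.eval t = Polynomial.evalRingHom t p := rfl
      rw [e1, RingHom.map_det]
      have e2 : (1 + t • A).det = LinearMap.det (LinearMap.id + t •
        (A : EuclideanSpace ℝ (Fin n) →ₗ[ℝ] EuclideanSpace ℝ (Fin n))) := rfl
      have e3 : LinearMap.toMatrix b b (LinearMap.id + t •
        (A : EuclideanSpace ℝ (Fin n) →ₗ[ℝ] EuclideanSpace ℝ (Fin n))) = 1 + t • M := by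
        rw [map_add, LinearMap.toMatrix_id, map_smul]
      rw [e2, ← LinearMap.det_toMatrix b, e3]
      congr 1
      ext i j
      by_cases hij : i = j
      · subst hij
        simp [M]
        ring
      · simp [M, hij]
        ring
    have hdeg : p.degree < (Finset.univ : Finset (Fin (n+1))).card := by
      have := Polynomial.natDegree_det_X_add_C_le M 1
      refine lt_of_le_of_lt Polynomial.degree_le_natDegree ?_
      simp only [Finset.card_univ, Fintype.card_fin] at this ⊢
      exact_mod_cast Nat.lt_succ_of_le this
    have h := Lagrange.eq_interpolate (hv.injOn) hdeg
    have h1 := hp 1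
    rw [one_smul] at h1
    rw [← h1]
    conv_lhs => rw [h]
    rw [Lagrange.interpolate_apply, Polynomial.eval_finsetSum]
    refine Finset.sum_congr rfl fun i _ => ?_
    rw [Polynomial.eval_mul, Polynomial.eval_C, hp, mul_comm]

lemma indicator_lip {E : Type*} [NormedAddCommGroup E] [NormedSpace ℝ E] {R : ℝ} {K : NNReal}
    {g : E → E} (hg : LipschitzOnWith K g (closedBall 0 R)) (h0 : ∀ x, ‖x‖ = R → g x = 0) :
    LipschitzWith K ((closedBall (0:E) R).indicator g) := by
  have key : ∀ x y : E, x ∈ closedBall (0:E) R → y ∉ closedBall (0:E) R →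
      ‖g x‖ ≤ K * ‖x - y‖ := by
    intro x y hx hy
    simp only [mem_closedBall, dist_zero_right, not_le] at hx hy
    have hc : ContinuousOn (fun t : ℝ => ‖AffineMap.lineMap x y t‖) (Icc (0:ℝ) 1) := by
      apply Continuous.continuousOn
      fun_prop
    obtain ⟨t, ht, htR⟩ := intermediate_value_Icc zero_le_one hc
      (show R ∈ Icc _ _ by simpa using ⟨hx, hy.le⟩)
    have h1 := hg.dist_le_mul x (by simpa using hx) (AffineMap.lineMap x y t)
      (by simpa using htR.le)
    rw [h0 _ htR, dist_zero_right, dist_left_lineMap] at h1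
    refine h1.trans ?_
    rw [dist_eq_norm, Real.norm_of_nonneg ht.1]
    gcongr
    exact mul_le_of_le_one_left (norm_nonneg _) ht.2
  refine LipschitzWith.of_dist_le_mul fun x y => ?_
  by_cases hx : x ∈ closedBall (0:E) R <;> by_cases hy : y ∈ closedBall (0:E) R
  · rw [indicator_of_mem hx, indicator_of_mem hy]
    exact hg.dist_le_mul x hx y hy
  · rw [indicator_of_mem hx, indicator_of_notMem hy, dist_zero_right, dist_eq_norm]
    exact key x y hx hy
  · rw [indicator_of_notMem hx, indicator_of_mem hy, dist_zero_left, dist_comm, dist_eq_norm]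
    exact key y x hy hx
  · rw [indicator_of_notMem hx, indicator_of_notMem hy, dist_self]
    positivity

lemma image_ball {E : Type*} [NormedAddCommGroup E] [NormedSpace ℝ E] [CompleteSpace E]
    [Nontrivial E] {R : ℝ} {K : NNReal}
    {g : E → E} (hg : LipschitzOnWith K g (closedBall 0 R)) (h0 : ∀ x, ‖x‖ = R → g x = 0)
    (hK : K < 1) :
    InjOn (fun x => x + g x) (closedBall 0 R) ∧
      (fun x => x + g x) '' (closedBall 0 R) = closedBall 0 R := by
  set B := closedBall (0:E) R with hB
  set F : E → E := fun x => x + B.indicator g x with hF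
  have hFB : ∀ x ∈ B, F x = x + g x := fun x hx => by simp [hF, indicator_of_mem hx]
  have hFn : ∀ x ∉ B, F x = x := fun x hx => by simp [hF, indicator_of_notMem hx]
  have happ : ApproximatesLinearOn F ((ContinuousLinearEquiv.refl ℝ E : E ≃L[ℝ] E) : E →L[ℝ] E)
      univ K := by
    rw [ApproximatesLinearOn.approximatesLinearOn_iff_lipschitzOnWith]
    have := (indicator_lip hg h0).lipschitzOnWith (s := univ)
    convert this using 1
    ext x
    simp [hF, hB]
  have hc : K < ‖((ContinuousLinearEquiv.refl ℝ E).symm : E →L[ℝ] E)‖₊⁻¹ := by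
    simpa using hK
  have hinj : InjOn F univ := happ.injOn (Or.inr hc)
  have hsurj := happ.surjective (Or.inr hc)
  have hmaps : ∀ x ∈ B, F x ∈ B := by
    intro x hx
    by_contra hn
    have := hinj (mem_univ _) (mem_univ _) (hFn _ hn)
    exact hn (this.symm ▸ hx)
  constructor
  · intro x hx y hy hxy
    apply hinj (mem_univ _) (mem_univ _)
    rw [hFB x hx, hFB y hy]; exact hxy
  · apply subset_antisymm
    · rintro _ ⟨x, hx, rfl⟩
      have := hmaps x hx
      rwa [hFB x hx] at this
    · intro y hy
      obtain ⟨x, rfl⟩ := hsurj y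
      by_cases hx : x ∈ B
      · exact ⟨x, hx, (hFB x hx).symm⟩
      · rw [hFn x hx] at hy; exact absurd hy hx

lemma volume_eq {n : ℕ} [NeZero n] {R : ℝ} 
    {g : EuclideanSpace ℝ (Fin n) → EuclideanSpace ℝ (Fin n)} (hg : ContDiff ℝ 1 g)
    (h0 : ∀ x, ‖x‖ = R → g x = 0) :
    ∫ x in closedBall (0 : EuclideanSpace ℝ (Fin n)) R, (1 + fderiv ℝ g x).det =
      (volume (closedBall (0 : EuclideanSpace ℝ (Fin n)) R)).toReal := by
  let E := EuclideanSpace ℝ (Fin n)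
  set B := closedBall (0:E) R with hB
  have hBc : IsCompact B := isCompact_closedBall _ _
  have hcd : Continuous (fderiv ℝ g) := hg.continuous_fderiv (by norm_num)
  have hdet : Continuous (fun A : E →L[ℝ] E => A.det) := ContinuousLinearMap.continuous_det
  obtain ⟨K0, hK0⟩ := hBc.exists_bound_of_continuousOn hcd.continuousOn
  set K : NNReal := ⟨max K0 0, le_max_right _ _⟩ with hK
  have hKb : ∀ x ∈ B, ‖fderiv ℝ g x‖ ≤ K := fun x hx => (hK0 x hx).trans (le_max_left _ _)
  have hlip : LipschitzOnWith K g B :=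
    (convex_closedBall _ _).lipschitzOnWith_of_nnnorm_fderiv_le
      (fun x _ => (hg.differentiable (by norm_num)) x) (fun x hx => hKb x hx)
  -- positivity of the determinant near the identity
  obtain ⟨δ, hδ, hpos⟩ : ∃ δ > 0, ∀ A : E →L[ℝ] E, ‖A‖ < δ → 0 < (1 + A).det := by
    have hcont : ContinuousAt (fun A : E →L[ℝ] E => (1 + A).det) 0 := by
      apply Continuous.continuousAt
      exact hdet.comp (continuous_const.add continuous_id)
    have h1 : ∀ᶠ A in 𝓝 (0 : E →L[ℝ] E), 0 < (1 + A).det := by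
      apply hcont.eventually (lt_mem_nhds _)
      simp [ContinuousLinearMap.det]
    obtain ⟨δ, hδ, h⟩ := Metric.eventually_nhds_iff.1 h1
    exact ⟨δ, hδ, fun A hA => h (by simpa using hA)⟩
  have hint : ∀ t : ℝ, IntegrableOn (fun x => (1 + t • fderiv ℝ g x).det) B := fun t =>
    (hdet.comp (continuous_const.add (hcd.const_smul t))).continuousOn.integrableOn_compact hBc
  have small : ∀ t : ℝ, 0 < t → t * K < 1 → t * K < δ →
      ∫ x in B, (1 + t • fderiv ℝ g x).det = (volume B).toReal := by
    intro t ht h1 h2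
    have hl : LipschitzOnWith (⟨t, ht.le⟩ * K) (fun x => t • g x) B := by
      refine LipschitzOnWith.of_dist_le_mul fun x hx y hy => ?_
      rw [dist_smul₀, Real.norm_of_nonneg ht.le]
      have := hlip.dist_le_mul x hx y hy
      calc t * dist (g x) (g y) ≤ t * (K * dist x y) := by gcongr
        _ = _ := by rw [← mul_assoc]; rfl
    obtain ⟨hi, him⟩ := image_ball hl (fun x hx => by simp [h0 x hx]) (by exact_mod_cast h1)
    have hder : ∀ x ∈ B, HasFDerivWithinAt (fun x => x + t • g x) (1 + t • fderiv ℝ g x) B x := by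
      intro x _
      exact ((hasFDerivAt_id x).add
        (((hg.differentiable (by norm_num)) x).hasFDerivAt.const_smul t)).hasFDerivWithinAt
    have hl := lintegral_abs_det_fderiv_eq_addHaar_image volume
      (isClosed_closedBall.measurableSet) hder hi
    rw [him] at hl
    rw [← hl, ← integral_toReal]
    · refine setIntegral_congr_fun isClosed_closedBall.measurableSet fun x hx => ?_
      have : 0 < (1 + t • fderiv ℝ g x).det := by
        apply hpos
        rw [norm_smul, Real.norm_of_nonneg ht.le]
        exact lt_of_le_of_lt (by gcongr; exact hKb x hx) h2
      simp [abs_of_pos this, ENNReal.toReal_ofReal this.le]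
    · apply AEMeasurable.ennreal_ofReal
      exact (continuous_abs.comp (hdet.comp (continuous_const.add (hcd.const_smul t)))).measurable.aemeasurable
    · simp
  -- nodes
  set ε : ℝ := min 1 δ / (K + 1) with hε
  have hK1 : (0:ℝ) < K + 1 := by positivity
  have hm : 0 < min 1 δ := lt_min one_pos hδ
  have hεpos : 0 < ε := by positivity
  have hεK : ε * K < min 1 δ := by
    rw [hε, div_mul_eq_mul_div, div_lt_iff₀ hK1]
    nlinarith [K.2]
  let v : Fin (n+1) → ℝ := fun i => ε / ((i : ℕ) + 1)
  have hv : Function.Injective v := by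
    intro i j hij
    have hi : (0:ℝ) < (i:ℕ) + 1 := by positivity
    have hj : (0:ℝ) < (j:ℕ) + 1 := by positivity
    simp only [v] at hij
    rw [div_eq_div_iff hi.ne' hj.ne'] at hij
    have := mul_left_cancel₀ hεpos.ne' hij
    ext
    have h3 : ((j:ℕ):ℝ) = (i:ℕ) := by linarith
    exact_mod_cast h3.symm
  have hvs : ∀ i, ∫ x in B, (1 + v i • fderiv ℝ g x).det = (volume B).toReal := by
    intro i
    have hi : (0:ℝ) < (i:ℕ) + 1 := by positivity
    have hle : v i ≤ ε := div_le_self hεpos.le (by linarith [(Nat.cast_nonneg (i:ℕ) : (0:ℝ) ≤ _)])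
    have : v i * K < min 1 δ := lt_of_le_of_lt (by gcongr) hεK
    exact small _ (by positivity) (this.trans_le (min_le_left _ _)) (this.trans_le (min_le_right _ _))
  obtain ⟨w, hw, hwd⟩ := det_interp v hv
  rw [show (fun x => (1 + fderiv ℝ g x).det) =
    fun x => ∑ i, w i * (1 + v i • fderiv ℝ g x).det from funext fun x => hwd _]
  rw [integral_finsetSum _ (fun i _ => (hint (v i)).const_mul (w i))]
  calc _ = ∑ i, w i * (volume B).toReal := by
        refine Finset.sum_congr rfl fun i _ => ?_
        rw [← hvs i]
        exact integral_const_mul _ _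
    _ = _ := by rw [← Finset.sum_mul, hw, one_mul]

lemma no_retract {n : ℕ} [NeZero n] {M : ℝ}
    {f : EuclideanSpace ℝ (Fin n) → EuclideanSpace ℝ (Fin n)} (hf : ContDiff ℝ 1 f)
    (hne : ∀ x, f x ≠ 0) (hid : ∀ x, M ≤ ‖x‖ → f x = x) : False := by
  set R := max M 1 with hR
  have hR0 : 0 < R := lt_max_of_lt_right one_pos
  set r : EuclideanSpace ℝ (Fin n) → EuclideanSpace ℝ (Fin n) := fun x => (R * ‖f x‖⁻¹) • f x with hr
  have hrc : ContDiff ℝ 1 r :=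
    (contDiff_const.mul ((hf.norm ℝ hne).inv fun x => norm_ne_zero_iff.2 (hne x))).smul hf
  have hrn : ∀ x, ‖r x‖ = R := by
    intro x
    have := norm_ne_zero_iff.2 (hne x)
    rw [hr]
    simp only [norm_smul, norm_mul, norm_inv, norm_norm, Real.norm_of_nonneg hR0.le]
    field_simp
  have hrd := hrc.differentiable (by norm_num)
  have hg : ContDiff ℝ 1 (fun x => r x - x) := hrc.sub contDiff_id
  have h := volume_eq (R := R) hg (by
    intro x hx
    have : f x = x := hid x (by rw [hx]; exact le_max_left _ _)
    simp only [hr, this, hx]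
    rw [mul_inv_cancel₀ hR0.ne', one_smul, sub_self])
  have hz : ∀ x, (1 + fderiv ℝ (fun x => r x - x) x).det = 0 := by
    intro x
    have h1 : fderiv ℝ (fun x => r x - x) x = fderiv ℝ r x - 1 := by
      exact ((hrd x).hasFDerivAt.sub (hasFDerivAt_id x)).fderiv
    rw [h1, add_sub_cancel]
    by_contra hdet
    have hu : IsUnit (LinearMap.det (fderiv ℝ r x : EuclideanSpace ℝ (Fin n) →ₗ[ℝ] _)) :=
      isUnit_iff_ne_zero.2 hdet
    obtain ⟨v, hv⟩ : ∃ v, fderiv ℝ r x v = r x := by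
      have := (LinearMap.equivOfIsUnitDet hu).surjective (r x)
      simpa using this
    have hc : HasFDerivAt (fun y => inner ℝ (r y) (r y)) _ x := 
      (hrd x).hasFDerivAt.inner ℝ (hrd x).hasFDerivAt
    have hc2 : HasFDerivAt (fun y => inner ℝ (r y) (r y)) (0 : _ →L[ℝ] ℝ) x := by
      simp only [real_inner_self_eq_norm_sq, hrn]
      exact hasFDerivAt_const _ _
    have := congrArg (fun L => L v) (hc.unique hc2)
    simp [hv, hrn] at this
    linarith
  simp_rw [hz] at h
  simp only [integral_zero] at h
  have hp : 0 < (volume (closedBall (0 : EuclideanSpace ℝ (Fin n)) R)).toReal :=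
    ENNReal.toReal_pos (measure_closedBall_pos _ _ hR0).ne' measure_closedBall_lt_top.ne
  linarith

lemma brouwer {n : ℕ} [NeZero n] {M : ℝ}
    {h : EuclideanSpace ℝ (Fin n) → EuclideanSpace ℝ (Fin n)} (hh : Continuous h)
    (hM : ∀ x, ‖h x‖ ≤ M) : ∃ x, h x = x := by
  by_contra! hfix
  have hM0 : 0 ≤ M := (norm_nonneg _).trans (hM 0)
  set χ : EuclideanSpace ℝ (Fin n) → ℝ := fun x => max 0 (min 1 (M + 2 - ‖x‖)) with hχ
  have hχc : Continuous χ := by fun_prop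
  have hχ0 : ∀ x, 0 ≤ χ x := fun x => le_max_left _ _
  have hχ1 : ∀ x, χ x ≤ 1 := fun x => max_le zero_le_one (min_le_left _ _)
  set F : EuclideanSpace ℝ (Fin n) → EuclideanSpace ℝ (Fin n) := fun x => x - χ x • h x with hF
  have hFc : Continuous F := by fun_prop
  have hFid : ∀ x, M + 2 ≤ ‖x‖ → F x = x := by
    intro x hx
    have : χ x = 0 := by
      simp only [hχ]
      exact max_eq_left ((min_le_right _ _).trans (by linarith))
    simp [hF, this]
  have hFne : ∀ x, F x ≠ 0 := by
    intro x hx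
    have hx' : x = χ x • h x := sub_eq_zero.1 hx
    have hn : ‖x‖ ≤ M := by
      calc ‖x‖ = ‖χ x • h x‖ := by rw [← hx']
        _ = χ x * ‖h x‖ := by rw [norm_smul, Real.norm_of_nonneg (hχ0 x)]
        _ ≤ 1 * M := mul_le_mul (hχ1 x) (hM x) (norm_nonneg _) zero_le_one
        _ = M := one_mul _
    have : χ x = 1 := by
      simp only [hχ]
      rw [min_eq_left (by linarith), max_eq_right zero_le_one]
    rw [this, one_smul] at hx'
    exact hfix x hx'.symm
  obtain ⟨g, hg, happ, heq, -⟩ := hFc.exists_contDiff_approx_and_eqOn 1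
    (ε := fun x => ‖F x‖) (by fun_prop) (fun x => norm_pos_iff.2 (hFne x))
    (S := {x | M + 3 ≤ ‖x‖}) (U := {x | M + 2 < ‖x‖})
    (isClosed_le continuous_const continuous_norm)
    ((isOpen_lt continuous_const continuous_norm).mem_nhdsSet.2 
      (fun x hx => by simp only [mem_ofPred_eq] at hx ⊢; linarith))
    (contDiffOn_id.congr fun x hx => hFid x (le_of_lt hx))
  refine no_retract (M := M + 3) hg ?_ ?_
  · intro x hx
    have := happ x
    rw [hx, dist_zero_left] at this
    exact lt_irrefl _ this
  · intro x hx
    rw [heq hx, hFid x (by linarith)]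

/-- Poincaré–Miranda on the unit cube. -/
lemma poincare_miranda {n : ℕ} [NeZero n] (F : Fin n → (Fin n → ℝ) → ℝ)
    (hF : ∀ k, Continuous (F k))
    (h0 : ∀ k s, s k = 0 → F k s ≤ 0) (h1 : ∀ k s, s k = 1 → 0 ≤ F k s) :
    ∃ s, ∀ k, F k s = 0 := by
  set cl : ℝ → ℝ := fun a => max 0 (min 1 a) with hcl
  have hclc : Continuous cl := by fun_prop
  let h : EuclideanSpace ℝ (Fin n) → EuclideanSpace ℝ (Fin n) := fun x =>
    WithLp.toLp 2 (fun k => cl (x k - F k (fun i => x i)))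
  have hh : Continuous h := by
    apply (PiLp.continuous_toLp 2 _).comp
    refine continuous_pi fun k => hclc.comp ?_
    refine Continuous.sub (by fun_prop) ((hF k).comp (by fun_prop))
  obtain ⟨x, hx⟩ := brouwer (M := √n) hh (by
    intro x
    rw [EuclideanSpace.norm_eq]
    apply Real.sqrt_le_sqrt
    calc ∑ i, ‖h x i‖ ^ 2 ≤ ∑ i : Fin n, (1:ℝ) := by
          refine Finset.sum_le_sum fun i _ => ?_
          have a : 0 ≤ h x i := le_max_left _ _
          have b : h x i ≤ 1 := max_le zero_le_one (min_le_left _ _)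
          rw [Real.norm_of_nonneg a]
          exact pow_le_one₀ a b
      _ = n := by simp)
  refine ⟨fun i => x i, fun k => ?_⟩
  have hk : cl (x k - F k (fun i => x i)) = x k := congrFun (congrArg WithLp.ofLp hx) k
  have e0 := h0 k (fun i => x i)
  have e1 := h1 k (fun i => x i)
  simp only [hcl] at hk
  rcases max_cases 0 (min 1 (x k - F k (fun i => x i))) with ⟨a, b⟩ | ⟨a, b⟩ <;>
  rcases min_cases 1 (x k - F k (fun i => x i)) with ⟨c, e⟩ | ⟨c, e⟩
  · linarith
  · have := e0 (by linarith); linarith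
  · have := e1 (by linarith); linarith
  · linarith

/-- Clamping to the unit interval. -/
noncomputable def hellyClamp (a : ℝ) : ℝ := max 0 (min 1 a)

lemma hellyClamp_mem (a : ℝ) : hellyClamp a ∈ Icc (0:ℝ) 1 :=
  ⟨le_max_left _ _, max_le zero_le_one (min_le_left _ _)⟩

lemma hellyClamp_cont : Continuous hellyClamp := by
  unfold hellyClamp; fun_prop

/-- The point at parameter `s` on the geodesic from `x` to `y`. -/
noncomputable def geoPt {X : Type*} [MetricSpace X] [ConvexMetricSpace X] (x y : X) (s : ℝ) : X :=
  (ConvexMetricSpace.geodesic x y).choose (hellyClamp s)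

lemma geoPt_zero {X : Type*} [MetricSpace X] [ConvexMetricSpace X] (x y : X) :
    geoPt x y 0 = x := by
  have := (ConvexMetricSpace.geodesic x y).choose_spec.1
  simpa [geoPt, hellyClamp] using this

lemma geoPt_one {X : Type*} [MetricSpace X] [ConvexMetricSpace X] (x y : X) :
    geoPt x y 1 = y := by
  have := (ConvexMetricSpace.geodesic x y).choose_spec.2.1
  simpa [geoPt, hellyClamp] using this

lemma geoPt_mem {X : Type*} [MetricSpace X] [ConvexMetricSpace X] {C : Set X} (hC : GeodConvex C)
    {x y : X} (hx : x ∈ C) (hy : y ∈ C) (s : ℝ) : geoPt x y s ∈ C :=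
  hC x hx y hy _ (ConvexMetricSpace.geodesic x y).choose_spec _ (hellyClamp_mem s)

lemma geoPt_dist {X : Type*} [MetricSpace X] [ConvexMetricSpace X] (x y x' y' : X) (s t : ℝ) :
    dist (geoPt x y s) (geoPt x' y' t) ≤
      dist x x' + dist y y' + |hellyClamp s - hellyClamp t| * dist x' y' := by
  have g1 := (ConvexMetricSpace.geodesic x y).choose_spec
  have g2 := (ConvexMetricSpace.geodesic x' y').choose_spec
  have hs := hellyClamp_mem s
  have ht := hellyClamp_mem t
  have hc := ConvexMetricSpace.convex _ _ _ _ _ _ g1 g2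
  have h1 : dist (geoPt x y s) (geoPt x' y' s) ≤ dist x x' + dist y y' := by
    have := (hc.2) (show (0:ℝ) ∈ Icc (0:ℝ) 1 by simp) (show (1:ℝ) ∈ Icc (0:ℝ) 1 by simp)
      (show 0 ≤ 1 - hellyClamp s by linarith [hs.2]) hs.1 (by ring)
    simp only [smul_eq_mul, mul_zero, mul_one, zero_add] at this
    rw [g1.1, g2.1, g1.2.1, g2.2.1] at this
    refine this.trans ?_
    have a := mul_le_of_le_one_left (dist_nonneg (x := x) (y := x')) (by linarith [hs.1] : 1 - hellyClamp s ≤ 1)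
    have b := mul_le_of_le_one_left (dist_nonneg (x := y) (y := y')) hs.2
    linarith
  have h2 : dist (geoPt x' y' s) (geoPt x' y' t) = |hellyClamp s - hellyClamp t| * dist x' y' :=
    g2.2.2 _ hs _ ht
  linarith [dist_triangle (geoPt x y s) (geoPt x' y' s) (geoPt x' y' t)]

lemma geoPt_cont {X : Type*} [MetricSpace X] [ConvexMetricSpace X] :
    Continuous (fun p : X × X × ℝ => geoPt p.1 p.2.1 p.2.2) := by
  rw [continuous_iff_continuousAt]
  rintro ⟨x, y, t⟩
  rw [ContinuousAt, tendsto_iff_dist_tendsto_zero]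
  refine squeeze_zero (fun _ => dist_nonneg) (fun p => geoPt_dist p.1 p.2.1 x y p.2.2 t) ?_
  have hc : Continuous (fun p : X × X × ℝ =>
      dist p.1 x + dist p.2.1 y + |hellyClamp p.2.2 - hellyClamp t| * dist x y) := by
    have := hellyClamp_cont
    fun_prop
  have := hc.tendsto (x, y, t)
  simpa using this

/-- Iterated geodesic coning. -/
noncomputable def coneIter {X : Type*} [MetricSpace X] [ConvexMetricSpace X] (x : ℕ → X)
    (s : ℕ → ℝ) : ℕ → X
  | 0 => x 0
  | k + 1 => geoPt (coneIter x s k) (x (k + 1)) (s k)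

lemma coneIter_cont {X : Type*} [MetricSpace X] [ConvexMetricSpace X] (x : ℕ → X) (k : ℕ) :
    Continuous (fun s => coneIter x s k) := by
  induction k with
  | zero => exact continuous_const
  | succ k ih =>
    exact geoPt_cont.comp (ih.prodMk (continuous_const.prodMk (continuous_apply k)))

lemma coneIter_mem {X : Type*} [MetricSpace X] [ConvexMetricSpace X] (x : ℕ → X) (s : ℕ → ℝ)
    {C : Set X} (hC : GeodConvex C) {a b : ℕ} (hab : a ≤ b) (ha : coneIter x s a ∈ C)
    (hx : ∀ j, a < j → j ≤ b → x j ∈ C) : coneIter x s b ∈ C := by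
  induction b, hab using Nat.le_induction with
  | base => exact ha
  | succ k hk ih =>
    exact geoPt_mem hC (ih fun j h1 h2 => hx j h1 (h2.trans (Nat.le_succ k)))
      (hx (k+1) (by omega) le_rfl) _

/-- No empty `r`-simplices for `r > d`. -/
lemma no_empty_simplex {X : Type*} [MetricSpace X] [ConvexMetricSpace X] {d : ℕ}
    (hdim : CoveringDimLE X d) {r : ℕ} (hr : d + 1 ≤ r) (D : Fin (r+1) → Set X)
    (hcl : ∀ i, IsClosed (D i)) (hconv : ∀ i, GeodConvex (D i))
    (hint : ∀ i, ∃ x, ∀ j, j ≠ i → x ∈ D j) : (⋂ i, D i).Nonempty := by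
  by_contra hemp
  rw [not_nonempty_iff_eq_empty] at hemp
  choose p hp using hint
  have : NeZero r := ⟨by omega⟩
  obtain ⟨κ, V, hVo, hVc, hVr, hVn⟩ := hdim (Fin (r+1)) (fun i => (D i)ᶜ)
    (fun i => (hcl i).isOpen_compl) (by rw [← compl_iInter, hemp, compl_empty])
  choose c hc using hVr
  let W : Fin (r+1) → Set X := fun i => ⋃ j, ⋃ (_ : c j = i), V j
  have hWo : ∀ i, IsOpen (W i) := fun i => isOpen_iUnion fun j => isOpen_iUnion fun _ => hVo j
  have hWD : ∀ i x, x ∈ D i → x ∉ W i := by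
    intro i x hx hW
    simp only [W, mem_iUnion] at hW
    obtain ⟨j, rfl, hj⟩ := hW
    exact hc j hj hx
  have hWcov : ∀ x, ∃ i, x ∈ W i := by
    intro x
    have : x ∈ ⋃ j, V j := by rw [hVc]; trivial
    obtain ⟨j, hj⟩ := mem_iUnion.1 this
    exact ⟨c j, by simp only [W, mem_iUnion]; exact ⟨j, rfl, hj⟩⟩
  have hWn : ∀ x, ∃ i, x ∉ W i := by
    intro x
    by_contra! hall
    simp only [W, mem_iUnion] at hall
    choose j hj hjV using hall
    have hinj : Function.Injective j := fun a b hab => by rw [← hj a, ← hj b, hab]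
    have h1 : (range j).ncard ≤ {j | x ∈ V j}.ncard :=
      ncard_le_ncard (by rintro _ ⟨i, rfl⟩; exact hjV i) (hVn x).1
    have h2 : (range j).ncard = r + 1 := by
      rw [← image_univ, ncard_image_of_injective _ hinj, ncard_univ]; simp
    have h3 := (hVn x).2
    omega
  let φ : Fin (r+1) → X → ℝ := fun i x => infDist x (W i)ᶜ
  have hφc : ∀ i, Continuous (φ i) := fun i => continuous_infDist_pt _
  have hφ0 : ∀ i x, x ∉ W i → φ i x = 0 := fun i x hx => infDist_zero_of_mem hx
  have hφnn : ∀ i x, 0 ≤ φ i x := fun i x => infDist_nonneg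
  have hne : ∀ i, (W i)ᶜ.Nonempty := by
    intro i
    obtain ⟨k, hk⟩ : ∃ k : Fin (r+1), i ≠ k := by
      have : Nontrivial (Fin (r+1)) := Fin.nontrivial_iff_two_le.2 (by omega)
      obtain ⟨k, hk⟩ := exists_ne i
      exact ⟨k, hk.symm⟩
    exact ⟨p k, hWD i _ (hp k i hk)⟩
  have hφpos : ∀ i x, x ∈ W i → 0 < φ i x := by
    intro i x hx
    exact ((hWo i).isClosed_compl.notMem_iff_infDist_pos (hne i)).1 (by simpa using hx)
  -- extended vertices and parameters
  let x : ℕ → X := fun k => if h : k < r + 1 then p ⟨k, h⟩ else p 0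
  have hx : ∀ k (i : Fin (r+1)), k < r + 1 → k ≠ i → x k ∈ D i := by
    intro k i hk hki
    simp only [x, hk, dif_pos]
    exact hp _ _ (fun h => hki (by rw [h]))
  let e : (Fin r → ℝ) → ℕ → ℝ := fun s k => if h : k < r then s ⟨k, h⟩ else 0
  have he : Continuous e := by
    refine continuous_pi fun k => ?_
    by_cases h : k < r
    · simp only [e, h, dif_pos]; exact continuous_apply _
    · simp only [e, h, dif_neg, not_false_eq_true]; exact continuous_const
  have hek : ∀ s (k : Fin r), e s k = s k := fun s k => by simp [e]
  let Q : (Fin r → ℝ) → X := fun s => coneIter x (e s) r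
  have hQ : Continuous Q := (coneIter_cont x r).comp he
  obtain ⟨s, hs⟩ := poincare_miranda
    (fun (k : Fin r) s => φ k.succ (Q s) - φ k.castSucc (Q s))
    (fun k => ((hφc _).comp hQ).sub ((hφc _).comp hQ))
    (by
      intro k s hk
      have hmem : Q s ∈ D k.succ := by
        have h1 : coneIter x (e s) k ∈ D k.succ := by
          refine coneIter_mem x _ (hconv _) (Nat.zero_le _) ?_ ?_
          · exact hx 0 _ (by omega) (by simp)
          · intro j _ hj
            exact hx j _ (by omega) (by simp; omega)
        have h2 : coneIter x (e s) (k+1) ∈ D k.succ := by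
          rw [coneIter, hek, hk, geoPt_zero]; exact h1
        refine coneIter_mem x _ (hconv _) (show (k:ℕ) + 1 ≤ r from k.2) h2 ?_
        intro j h3 h4
        exact hx j _ (by omega) (by simp; omega)
      have := hφ0 _ _ (hWD _ _ hmem)
      have := hφnn k.castSucc (Q s)
      linarith)
    (by
      intro k s hk
      have hmem : Q s ∈ D k.castSucc := by
        have h2 : coneIter x (e s) (k+1) ∈ D k.castSucc := by
          rw [coneIter, hek, hk, geoPt_one]
          exact hx _ _ (by omega) (by simp)
        refine coneIter_mem x _ (hconv _) (show (k:ℕ) + 1 ≤ r from k.2) h2 ?_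
        intro j h3 h4
        exact hx j _ (by omega) (by simp; omega)
      have := hφ0 _ _ (hWD _ _ hmem)
      have := hφnn k.succ (Q s)
      linarith)
  have hall : ∀ i, φ i (Q s) = φ 0 (Q s) := by
    intro i
    induction i using Fin.induction with
    | zero => rfl
    | succ k ih => have := hs k; linarith
  obtain ⟨i, hi⟩ := hWcov (Q s)
  obtain ⟨j, hj⟩ := hWn (Q s)
  have a := hφpos i _ hi
  have b := hφ0 j _ hj
  rw [hall] at a b
  linarith

end HellyAux

/-- Metric Helly theorem: in a convex metric space of covering dimension at most d, a finite
family of closed convex sets, each (d+1) of which intersect, has a common point. -/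
theorem metric_helly {X : Type*} [MetricSpace X] [ConvexMetricSpace X] {d : ℕ}
    (hdim : CoveringDimLE X d) {m : ℕ} (hm : 0 < m) (C : Fin m → Set X)
    (hcl : ∀ i, IsClosed (C i)) (hconv : ∀ i, GeodConvex (C i))
    (hint : ∀ I : Finset (Fin m), I.Nonempty → I.card ≤ d + 1 → (⋂ i ∈ I, C i).Nonempty) :
    (⋂ i, C i).Nonempty := by
  have key : ∀ k : ℕ, ∀ I : Finset (Fin m), I.card = k → I.Nonempty →
      (⋂ i ∈ I, C i).Nonempty := by
    intro k
    induction k with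
    | zero => intro I h0 hne; exact absurd h0 (Finset.card_pos.2 hne).ne'
    | succ r ih =>
      intro I hI hne
      by_cases hr : r + 1 ≤ d + 1
      · exact hint I hne (by omega)
      · let f := I.equivFinOfCardEq hI
        obtain ⟨x, hx⟩ := no_empty_simplex hdim (r := r) (by omega)
          (fun i => C (f.symm i)) (fun i => hcl _) (fun i => hconv _) (by
            intro i
            obtain ⟨x, hx⟩ := ih (I.erase (f.symm i)) (by
              rw [Finset.card_erase_of_mem (f.symm i).2, hI]; rfl) (by
              rw [← Finset.card_pos, Finset.card_erase_of_mem (f.symm i).2, hI]; omega)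
            refine ⟨x, fun j hj => ?_⟩
            simp only [Set.mem_iInter] at hx
            refine hx _ (Finset.mem_erase.2 ⟨fun h => hj ?_, (f.symm j).2⟩)
            exact f.symm.injective (Subtype.ext h))
        refine ⟨x, ?_⟩
        simp only [Set.mem_iInter] at hx ⊢
        intro i hi
        have := hx (f ⟨i, hi⟩)
        simpa using this
  have : Nonempty (Fin m) := ⟨⟨0, hm⟩⟩
  have := key _ Finset.univ rfl Finset.univ_nonempty
  simpa using this
end

section
/- (Product Lemma with torsion) Let Γ₁, …, Γ_d be groups, each of which has a finite generating set consisting of elements of finite order. Whenever Γ₁ × ⋯ × Γ_d acts by isometries on a complete CAT(0) space of topological dimension less than d, at least one factor Γ_i has a global fixed point. -/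
/-- The indicator (mod 2) that all labels `0, …, m-1` occur. -/
noncomputable def fullLab (m : ℕ) (a : Fin m → ℕ) : ZMod 2 :=
  open Classical in if ∀ l < m, ∃ k, a k = l then 1 else 0

/-- The `k`-th vertex of the Kuhn simplex with base `x` and ordering `ρ`. -/
def vtx {d : ℕ} (x : Fin d → ℕ) (ρ : Equiv.Perm (Fin d)) (k : ℕ) : Fin d → ℕ :=
  fun c => x c + if (ρ c : ℕ) < k then 1 else 0

lemma fullLab_eq_one {m : ℕ} {a : Fin m → ℕ} (h : ∀ l < m, ∃ k, a k = l) : fullLab m a = 1 := by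
  unfold fullLab; rw [if_pos h]

lemma fullLab_eq_zero {m : ℕ} {a : Fin m → ℕ} {l : ℕ} (hl : l < m) (h : ∀ k, a k ≠ l) :
    fullLab m a = 0 := by
  unfold fullLab; rw [if_neg]
  intro H
  obtain ⟨k, hk⟩ := H l hl
  exact h k hk

lemma fullLab_inj {m : ℕ} {a : Fin m → ℕ} (h : ∀ l < m, ∃ k, a k = l) : Function.Injective a := by
  choose g hg using h
  have hg' : Function.Injective (fun l : Fin m => g l l.2) := by
    intro p q hpq
    have h1 := hg p p.2
    have h2 := hg q q.2
    simp only at hpq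
    rw [hpq, h2] at h1
    exact Fin.ext h1.symm
  have hs := Finite.surjective_of_injective hg'
  intro p q hpq
  obtain ⟨p', rfl⟩ := hs p
  obtain ⟨q', rfl⟩ := hs q
  simp only [hg _ p'.2, hg _ q'.2] at hpq
  rw [Fin.ext hpq]

lemma fullLab_zero_of_eq {m : ℕ} {a : Fin m → ℕ} {p q : Fin m} (hne : p ≠ q) (h : a p = a q) :
    fullLab m a = 0 := by
  unfold fullLab; rw [if_neg]
  intro H
  exact hne (fullLab_inj H h)

lemma fullLab_succ {m : ℕ} (a : Fin (m+1) → ℕ) (ha : ∀ k, a k ≤ m) :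
    fullLab (m+1) a = ∑ k : Fin (m+1), fullLab m (fun j => a (k.succAbove j)) := by
  by_cases hm : ∀ l < m, ∃ k, a k = l
  · by_cases hl : ∃ k, a k = m
    · obtain ⟨k0, hk0⟩ := hl
      have hfull : ∀ l < m+1, ∃ k, a k = l := by
        intro l hl
        rcases Nat.lt_succ_iff_lt_or_eq.mp hl with h | h
        · exact hm l h
        · exact ⟨k0, h ▸ hk0⟩
      rw [fullLab_eq_one hfull, Finset.sum_eq_single k0]
      · rw [fullLab_eq_one]
        intro l hl
        obtain ⟨k, hk⟩ := hm l hl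
        have : k ≠ k0 := by rintro rfl; omega
        obtain ⟨j, rfl⟩ := Fin.exists_succAbove_eq this
        exact ⟨j, hk⟩
      · intro k _ hk
        refine fullLab_eq_zero (l := a k) ?_ ?_
        · have := ha k
          have h2 : a k ≠ m := fun h => hk (fullLab_inj hfull (h.trans hk0.symm))
          omega
        · intro j hj
          exact Fin.succAbove_ne k j (fullLab_inj hfull hj)
      · simp
    · push Not at hl
      rw [fullLab_eq_zero (Nat.lt_succ_self m) hl]
      have hlt : ∀ k, a k < m := fun k => lt_of_le_of_ne (ha k) (hl k)
      obtain ⟨p, q, hpq, heq⟩ := Fintype.exists_ne_map_eq_of_card_lt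
        (fun k : Fin (m+1) => (⟨a k, hlt k⟩ : Fin m)) (by simp)
      simp only [Fin.mk.injEq] at heq
      have key : ∀ p q : Fin (m+1), p ≠ q → a p = a q →
          fullLab m (fun j => a (p.succAbove j)) = 1 := by
        intro p q hpq heq
        apply fullLab_eq_one
        intro l hl
        obtain ⟨k, hk⟩ := hm l hl
        by_cases hkp : k = p
        · obtain ⟨j, hj⟩ := Fin.exists_succAbove_eq hpq.symm
          exact ⟨j, by rw [hj, ← heq, ← hkp, hk]⟩
        · obtain ⟨j, hj⟩ := Fin.exists_succAbove_eq hkp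
          exact ⟨j, by rw [hj, hk]⟩
      rw [← Finset.sum_subset (Finset.subset_univ {p, q}), Finset.sum_pair hpq, key p q hpq heq,
        key q p hpq.symm heq.symm]
      · decide
      · intro k _ hk
        simp only [Finset.mem_insert, Finset.mem_singleton, not_or] at hk
        obtain ⟨j, hj⟩ := Fin.exists_succAbove_eq (Ne.symm hk.1)
        obtain ⟨j', hj'⟩ := Fin.exists_succAbove_eq (Ne.symm hk.2)
        refine fullLab_zero_of_eq (p := j) (q := j') ?_ (by simp only [hj, hj', heq])
        rintro rfl
        exact hpq (hj.symm.trans hj')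
  · push Not at hm
    obtain ⟨l, hl, h⟩ := hm
    rw [fullLab_eq_zero (Nat.lt_succ_of_lt hl) h, Finset.sum_eq_zero]
    intro k _
    exact fullLab_eq_zero hl fun j => h _

lemma zmod2_add_self (a : ZMod 2) : a + a = 0 := CharTwo.add_self_eq_zero a

lemma telescope_range (n : ℕ) (h : ℕ → ZMod 2) :
    ∑ a : Fin n, (h (a + 1) + h a) = h 0 + h n := by
  rw [Fin.sum_univ_eq_sum_range (fun a => h (a+1) + h a) n]
  induction n with
  | zero => simp [zmod2_add_self]
  | succ k ih =>
    rw [Finset.sum_range_succ, ih]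
    have := zmod2_add_self (h k)
    linear_combination this

lemma telescope {d : ℕ} (n : ℕ) (i : Fin (d+1)) (h : (Fin (d+1) → ℕ) → ZMod 2) :
    ∑ x : Fin (d+1) → Fin n, (h (fun c => (x c : ℕ) + if c = i then 1 else 0) + h (fun c => x c))
    = ∑ y : Fin d → Fin n, (h (i.insertNth 0 (fun c => (y c : ℕ)))
        + h (i.insertNth n (fun c => (y c : ℕ)))) := by
  rw [← Equiv.sum_comp (Fin.insertNthEquiv (fun _ => Fin n) i), Fintype.sum_prod_type_right]
  refine Finset.sum_congr rfl fun y _ => ?_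
  rw [← telescope_range n (fun a => h (i.insertNth a (fun c => (y c : ℕ))))]
  refine Finset.sum_congr rfl fun a _ => ?_
  congr 2
  · funext c
    refine Fin.succAboveCases i ?_ (fun j => ?_) c
    · simp
    · simp
  · funext c
    refine Fin.succAboveCases i ?_ (fun j => ?_) c
    · simp
    · simp

/-- Extend a permutation of `Fin d` by fixing the last point. -/
def extP {d : ℕ} (σ : Equiv.Perm (Fin d)) : Equiv.Perm (Fin (d+1)) :=
  (Equiv.permCongr finSuccEquivLast.symm) (Equiv.Perm.decomposeOption.symm (none, σ))

lemma extP_last {d : ℕ} (σ : Equiv.Perm (Fin d)) : extP σ (Fin.last d) = Fin.last d := by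
  simp [extP]

lemma extP_castSucc {d : ℕ} (σ : Equiv.Perm (Fin d)) (c : Fin d) :
    extP σ c.castSucc = (σ c).castSucc := by
  simp [extP]

lemma perm_sum {d : ℕ} (F : Equiv.Perm (Fin (d+1)) → ZMod 2)
    (hF : ∀ ρ, ρ (Fin.last d) ≠ Fin.last d → F ρ = 0) :
    ∑ ρ, F ρ = ∑ σ : Equiv.Perm (Fin d), F (extP σ) := by
  rw [← Equiv.sum_comp (Equiv.permCongr (finSuccEquivLast (n := d)).symm),
    ← Equiv.sum_comp Equiv.Perm.decomposeOption.symm, Fintype.sum_prod_type,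
    Fintype.sum_option]
  refine add_eq_left.mpr ?_
  · refine Finset.sum_eq_zero fun o _ => Finset.sum_eq_zero fun σ _ => hF _ ?_
    simp [Fin.castSucc_ne_last]

lemma vtx_le {d n : ℕ} (x : Fin d → Fin n) (ρ : Equiv.Perm (Fin d)) (k : ℕ) (c : Fin d) :
    vtx (fun c => (x c : ℕ)) ρ k c ≤ n := by
  unfold vtx
  have := (x c).2
  dsimp only
  split_ifs <;> omega

theorem kuhn_sum (n : ℕ) (hn : 0 < n) : ∀ (d : ℕ) (L : (Fin d → ℕ) → ℕ)
    (_ : ∀ x, (∀ i, x i ≤ n) → L x ≤ d)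
    (_ : ∀ x (i : Fin d), (∀ i, x i ≤ n) → x i = 0 → L x ≤ i)
    (_ : ∀ x (i : Fin d), (∀ i, x i ≤ n) → x i = n → L x ≠ i),
    ∑ x : Fin d → Fin n, ∑ ρ : Equiv.Perm (Fin d),
      fullLab (d+1) (fun k => L (vtx (fun c => (x c : ℕ)) ρ k)) = 1 := by
  intro d
  induction d with
  | zero =>
    intro L h0 _ _
    simp only [Finset.univ_unique, Finset.sum_singleton]
    apply fullLab_eq_one
    intro l hl
    refine ⟨0, ?_⟩
    have := h0 (vtx (fun c => ((default : Fin 0 → Fin n) c : ℕ)) default ((0 : Fin 1) : ℕ)) (fun i => i.elim0)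
    simp only [zero_add] at *
    omega
  | succ d ih =>
    intro L h0 h1 h2
    have step1 : ∀ (x : Fin (d+1) → Fin n) (ρ : Equiv.Perm (Fin (d+1))),
        fullLab (d+1+1) (fun k => L (vtx (fun c => (x c : ℕ)) ρ k)) =
        ∑ k : Fin (d+2), fullLab (d+1) (fun j => L (vtx (fun c => (x c : ℕ)) ρ (k.succAbove j))) := by
      intro x ρ
      exact fullLab_succ _ fun k => h0 _ (vtx_le x ρ k)
    -- middle faces cancel
    have mid : ∀ (x : Fin (d+1) → Fin n) (j : Fin d),
        ∑ ρ : Equiv.Perm (Fin (d+1)), fullLab (d+1)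
          (fun t => L (vtx (fun c => (x c : ℕ)) ρ ((j.castSucc.succ : Fin (d+2)).succAbove t))) = 0 := by
      intro x j
      refine Finset.sum_involution (fun ρ _ => Equiv.swap j.castSucc j.succ * ρ) ?_ ?_ ?_ ?_
      · intro ρ _
        convert zmod2_add_self _ using 5 with t
        funext c
        unfold vtx
        congr 1
        have hne : ((j.castSucc.succ : Fin (d+2)).succAbove t : ℕ) ≠ j + 1 := by
          intro h
          exact Fin.succAbove_ne (j.castSucc.succ) t (Fin.ext (by simpa using h))
        generalize ((j.castSucc.succ : Fin (d+2)).succAbove t : ℕ) = k at hne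
        congr 1
        rw [Equiv.Perm.mul_apply]
        generalize ρ c = r
        rw [Equiv.swap_apply_def]
        split_ifs with e1 e2
        · subst e1; simp; omega
        · subst e2; simp; omega
        · rfl
      · intro ρ _ _ h
        have := mul_eq_right.mp h
        rw [Equiv.swap_eq_one_iff] at this
        have := congrArg Fin.val this
        simp at this
      · intros; simp
      · intros; simp [← mul_assoc]
    have hsum : ∑ x : Fin (d+1) → Fin n, ∑ ρ : Equiv.Perm (Fin (d+1)),
        fullLab (d+1+1) (fun k => L (vtx (fun c => (x c : ℕ)) ρ k)) =
        ∑ x : Fin (d+1) → Fin n, ((∑ ρ : Equiv.Perm (Fin (d+1)),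
          fullLab (d+1) (fun j => L (vtx (fun c => (x c : ℕ)) ρ (j+1)))) +
          ∑ ρ : Equiv.Perm (Fin (d+1)),
          fullLab (d+1) (fun j => L (vtx (fun c => (x c : ℕ)) ρ j))) := by
      refine Finset.sum_congr rfl fun x _ => ?_
      simp_rw [step1]
      rw [Finset.sum_comm, Fin.sum_univ_succ, Fin.sum_univ_castSucc]
      simp_rw [mid]
      simp
    rw [hsum]
    -- rotate
    have rot : ∀ x : Fin (d+1) → Fin n, ∑ ρ : Equiv.Perm (Fin (d+1)),
          fullLab (d+1) (fun j => L (vtx (fun c => (x c : ℕ)) ρ (j+1))) =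
        ∑ ρ : Equiv.Perm (Fin (d+1)), fullLab (d+1) (fun j => L (vtx
          (fun c => (x c : ℕ) + if c = ρ.symm (Fin.last d) then 1 else 0) ρ j)) := by
      intro x
      rw [← Equiv.sum_comp (Equiv.mulLeft (finRotate (d+1)))]
      refine Finset.sum_congr rfl fun ρ _ => ?_
      congr 1
      funext j
      congr 1
      funext c
      unfold vtx
      dsimp only
      have hj := j.2
      have hlt := (ρ c).2
      have e0 : (((Equiv.mulLeft (finRotate (d+1))) ρ) c : ℕ) = finRotate (d+1) (ρ c) := rfl
      by_cases hr : ρ c = Fin.last d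
      · have e1 : ((finRotate (d+1) (ρ c) : Fin (d+1)) : ℕ) = 0 := by rw [hr, finRotate_last]; rfl
        have e2 : (ρ c : ℕ) = d := by rw [hr]; rfl
        rw [if_pos ((Equiv.eq_symm_apply ρ).mpr hr), if_pos (by omega), if_neg (by omega)]
      · have e1 := coe_finRotate_of_ne_last hr
        have e2 : (ρ c : ℕ) < d := Fin.val_lt_last hr
        rw [if_neg (fun h => hr ((Equiv.eq_symm_apply ρ).mp h))]
        rw [e1] at e0
        rw [add_zero]
        congr 1
        exact if_congr (by omega) rfl rfl
    simp_rw [rot]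
    simp_rw [← Finset.sum_add_distrib]
    rw [Finset.sum_comm]
    have tel : ∀ ρ : Equiv.Perm (Fin (d+1)), 
        ∑ x : Fin (d+1) → Fin n, (fullLab (d+1) (fun j => L (vtx
          (fun c => (x c : ℕ) + if c = ρ.symm (Fin.last d) then 1 else 0) ρ j)) +
          fullLab (d+1) (fun j => L (vtx (fun c => (x c : ℕ)) ρ j))) =
        ∑ y : Fin d → Fin n, fullLab (d+1) (fun j => L (vtx
          ((ρ.symm (Fin.last d)).insertNth (0:ℕ) (fun c => (y c : ℕ))) ρ j)) := by
      intro ρ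
      rw [telescope n (ρ.symm (Fin.last d)) (fun z => fullLab (d+1) (fun j => L (vtx z ρ j)))]
      refine Finset.sum_congr rfl fun y _ => ?_
      rw [add_eq_left]
      refine fullLab_eq_zero (l := ρ.symm (Fin.last d)) (Fin.is_lt _) fun j => ?_
      apply h2
      · intro c
        unfold vtx
        refine Fin.succAboveCases (ρ.symm (Fin.last d)) ?_ (fun t => ?_) c
        · have := j.2
          simp; omega
        · have := (y t).2
          simp; split_ifs <;> omega
      · have := j.2
        unfold vtx; simp; omega
    simp_rw [tel]
    have bd : ∀ (ρ : Equiv.Perm (Fin (d+1))) (y : Fin d → Fin n) (j : Fin (d+1)) (c : Fin (d+1)),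
        vtx ((ρ.symm (Fin.last d)).insertNth (0:ℕ) (fun c => (y c : ℕ))) ρ j c ≤ n := by
      intro ρ y j c
      unfold vtx
      refine Fin.succAboveCases (ρ.symm (Fin.last d)) ?_ (fun t => ?_) c
      · have := j.2
        simp; split_ifs <;> omega
      · have := (y t).2
        simp; split_ifs <;> omega
    rw [perm_sum]
    · rw [Finset.sum_comm]
      have := ih (fun z => L (Fin.snoc (α := fun _ => ℕ) z 0)) ?_ ?_ ?_
      · rw [← this]
        refine Finset.sum_congr rfl fun y _ => Finset.sum_congr rfl fun σ _ => ?_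
        congr 1
        funext j
        congr 1
        have hl : (extP σ).symm (Fin.last d) = Fin.last d := by
          rw [Equiv.symm_apply_eq, extP_last]
        rw [hl, Fin.insertNth_last']
        funext c
        refine Fin.lastCases ?_ (fun t => ?_) c
        · have := j.2
          simp [vtx, extP_last]; omega
        · simp [vtx, extP_castSucc]
      · intro x hx
        have := h1 (Fin.snoc (α := fun _ => ℕ) x 0) (Fin.last d) ?_ (by simp)
        · simpa using this
        · intro i
          refine Fin.lastCases ?_ (fun t => ?_) i
          · simp
          · simpa using hx t
      · intro x i hx hi
        have := h1 (Fin.snoc (α := fun _ => ℕ) x 0) i.castSucc ?_ (by simpa using hi)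
        · simpa using this
        · intro i
          refine Fin.lastCases ?_ (fun t => ?_) i
          · simp
          · simpa using hx t
      · intro x i hx hi
        have := h2 (Fin.snoc (α := fun _ => ℕ) x 0) i.castSucc ?_ (by simpa using hi)
        · simpa using this
        · intro i
          refine Fin.lastCases ?_ (fun t => ?_) i
          · simp
          · simpa using hx t
    · intro ρ hρ
      refine Finset.sum_eq_zero fun y _ => ?_
      refine fullLab_eq_zero (l := d) (Nat.lt_succ_self d) fun j => ?_
      have hne : ρ.symm (Fin.last d) ≠ Fin.last d := by
        intro h
        rw [Equiv.symm_apply_eq] at h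
        exact hρ h.symm
      have hlt : (ρ.symm (Fin.last d) : ℕ) < d := Fin.val_lt_last hne
      have := h1 (vtx ((ρ.symm (Fin.last d)).insertNth (0:ℕ) (fun c => (y c : ℕ))) ρ j)
        (ρ.symm (Fin.last d)) (bd ρ y j) (by have := j.2; unfold vtx; simp; omega)
      omega

theorem kuhn_lemma (n : ℕ) (hn : 0 < n) (d : ℕ) (L : (Fin d → ℕ) → ℕ)
    (h0 : ∀ x, (∀ i, x i ≤ n) → L x ≤ d)
    (h1 : ∀ x (i : Fin d), (∀ i, x i ≤ n) → x i = 0 → L x ≤ i)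
    (h2 : ∀ x (i : Fin d), (∀ i, x i ≤ n) → x i = n → L x ≠ i) :
    ∃ v : Fin (d+1) → Fin d → ℕ, (∀ k i, v k i ≤ n) ∧ (∀ k k' i, v k i ≤ v k' i + 1) ∧
      Function.Injective (fun k => L (v k)) := by
  have := kuhn_sum n hn d L h0 h1 h2
  have hne : ∑ x : Fin d → Fin n, ∑ ρ : Equiv.Perm (Fin d),
      fullLab (d+1) (fun k => L (vtx (fun c => (x c : ℕ)) ρ k)) ≠ 0 := by
    rw [this]; decide
  obtain ⟨x, _, hx⟩ := Finset.exists_ne_zero_of_sum_ne_zero hne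
  obtain ⟨ρ, _, hρ⟩ := Finset.exists_ne_zero_of_sum_ne_zero hx
  refine ⟨fun k => vtx (fun c => (x c : ℕ)) ρ k, fun k i => vtx_le x ρ k i, ?_, ?_⟩
  · intro k k' i
    simp only [vtx]
    split_ifs <;> omega
  · apply fullLab_inj
    by_contra h
    apply hρ
    unfold fullLab
    rw [if_neg h]

section CATZero
variable {X : Type} [MetricSpace X] [CAT0Space X]

lemma cn_geod (p x y : X) (γ : ℝ → X) (h : IsGeodesicSeg x y γ) (t : ℝ)
    (ht : t ∈ Set.Icc (0:ℝ) 1) :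
    dist p (γ t) ^ 2 ≤ (1 - t) * dist p x ^ 2 + t * dist p y ^ 2 - t * (1 - t) * dist x y ^ 2 := by
  obtain ⟨h0, h1, hd⟩ := h
  set D := dist x y with hD
  have hD0 : 0 ≤ D := dist_nonneg
  set g : ℝ → ℝ := fun s => dist p (γ s) ^ 2 -
    ((1 - s) * dist p x ^ 2 + s * dist p y ^ 2 - s * (1 - s) * D ^ 2) with hg
  have hγ : ContinuousOn γ (Set.Icc 0 1) := by
    have : LipschitzOnWith ⟨D, hD0⟩ γ (Set.Icc 0 1) := by
      apply LipschitzOnWith.of_dist_le_mul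
      intro s hs t ht
      rw [hd s hs t ht, Real.dist_eq, mul_comm]
      rfl
    exact this.continuousOn
  have hgc : ContinuousOn g (Set.Icc 0 1) := by
    rw [hg]
    apply ContinuousOn.sub
    · exact ((continuous_const.dist continuous_id).comp_continuousOn hγ).pow 2
    · fun_prop
  have hmid : ∀ a ∈ Set.Icc (0:ℝ) 1, ∀ b ∈ Set.Icc (0:ℝ) 1, a ≤ b →
      g ((a + b) / 2) ≤ (g a + g b) / 2 := by
    intro a ha b hb hab
    have hm : (a + b) / 2 ∈ Set.Icc (0:ℝ) 1 := ⟨by linarith [ha.1, hb.1], by linarith [ha.2, hb.2]⟩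
    have e1 := hd a ha b hb
    have e2 := hd a ha _ hm
    have e3 := hd b hb _ hm
    rw [abs_of_nonpos (by linarith)] at e1 e2
    rw [abs_of_nonneg (by linarith)] at e3
    have := CAT0Space.cn p (γ a) (γ b) (γ ((a + b) / 2)) (by rw [e1, e2]; ring)
      (by rw [e1, e3]; ring)
    rw [e1] at this
    simp only [hg]
    nlinarith [this]
  obtain ⟨m, hm, hmax⟩ := isCompact_Icc.exists_isMaxOn (Set.nonempty_Icc.mpr zero_le_one) hgc
  have hg0 : g 0 = 0 := by simp [hg, h0]
  have hg1 : g 1 = 0 := by simp [hg, h1]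
  have hle : g m ≤ 0 := by
    rcases le_total m (1/2) with h | h
    · have hb : 2 * m ∈ Set.Icc (0:ℝ) 1 := ⟨by linarith [hm.1], by linarith⟩
      have := hmid 0 (by simp) (2 * m) hb hb.1
      have h2 := hmax hb
      simp only [Set.mem_ofPred_eq] at h2
      rw [show (0 + 2 * m) / 2 = m by ring, hg0] at this
      linarith
    · have hb : 2 * m - 1 ∈ Set.Icc (0:ℝ) 1 := ⟨by linarith, by linarith [hm.2]⟩
      have := hmid (2 * m - 1) hb 1 (by simp) hb.2
      have h2 := hmax hb
      simp only [Set.mem_ofPred_eq] at h2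
      rw [show (2 * m - 1 + 1) / 2 = m by ring, hg1] at this
      linarith
  have h3 := hmax ht
  simp only [Set.mem_ofPred_eq] at h3
  have : g t ≤ 0 := h3.trans hle
  simp only [hg] at this
  linarith

lemma geod_unique (x y q : X) (γ : ℝ → X) (h : IsGeodesicSeg x y γ) (t : ℝ)
    (ht : t ∈ Set.Icc (0:ℝ) 1) (h1 : dist q x = t * dist x y) (h2 : dist q y = (1 - t) * dist x y) :
    q = γ t := by
  have := cn_geod q x y γ h t ht
  rw [h1, h2] at this
  have h0 : dist q (γ t) ^ 2 ≤ 0 := by nlinarith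
  have : dist q (γ t) = 0 := by
    have := sq_nonneg (dist q (γ t))
    exact pow_eq_zero_iff (two_ne_zero) |>.mp (le_antisymm h0 this)
  exact dist_eq_zero.mp this

/-- The chosen geodesic, with parameter clamped to `[0,1]`. -/
noncomputable def geo (x y : X) (t : ℝ) : X :=
  Classical.choose (CAT0Space.geodesic x y) (Set.projIcc 0 1 zero_le_one t)

lemma geo_spec (x y : X) : ∃ γ : ℝ → X, IsGeodesicSeg x y γ ∧
    ∀ t, geo x y t = γ (Set.projIcc (0:ℝ) 1 zero_le_one t) :=
  ⟨_, Classical.choose_spec (CAT0Space.geodesic x y), fun _ => rfl⟩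

lemma geo_zero (x y : X) : geo x y 0 = x := by
  obtain ⟨γ, h, e⟩ := geo_spec x y
  rw [e]; simpa using h.1

lemma geo_one (x y : X) : geo x y 1 = y := by
  obtain ⟨γ, h, e⟩ := geo_spec x y
  rw [e]; simpa using h.2.1

lemma geo_dist_left (x y : X) (t : ℝ) :
    dist (geo x y t) x = (Set.projIcc (0:ℝ) 1 zero_le_one t : ℝ) * dist x y := by
  obtain ⟨γ, h, e⟩ := geo_spec x y
  rw [e]
  have hp := (Set.projIcc (0:ℝ) 1 zero_le_one t).2
  generalize (Set.projIcc (0:ℝ) 1 zero_le_one t : ℝ) = s at *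
  have := h.2.2 s hp 0 (by simp)
  rw [h.1, sub_zero, abs_of_nonneg hp.1] at this
  exact this

lemma geo_dist_right (x y : X) (t : ℝ) :
    dist (geo x y t) y = (1 - (Set.projIcc (0:ℝ) 1 zero_le_one t : ℝ)) * dist x y := by
  obtain ⟨γ, h, e⟩ := geo_spec x y
  rw [e]
  have hp := (Set.projIcc (0:ℝ) 1 zero_le_one t).2
  generalize (Set.projIcc (0:ℝ) 1 zero_le_one t : ℝ) = s at *
  have := h.2.2 s hp 1 (by simp)
  rw [h.2.1, abs_of_nonpos (by linarith [hp.2])] at this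
  rw [this]; ring

lemma geo_cn (p x y : X) (t : ℝ) : dist p (geo x y t) ^ 2 ≤
    (1 - (Set.projIcc (0:ℝ) 1 zero_le_one t : ℝ)) * dist p x ^ 2
    + (Set.projIcc (0:ℝ) 1 zero_le_one t : ℝ) * dist p y ^ 2
    - (Set.projIcc (0:ℝ) 1 zero_le_one t : ℝ) * (1 - (Set.projIcc (0:ℝ) 1 zero_le_one t : ℝ))
      * dist x y ^ 2 := by
  obtain ⟨γ, h, e⟩ := geo_spec x y
  rw [e]
  exact cn_geod p x y γ h _ (Set.projIcc (0:ℝ) 1 zero_le_one t).2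

lemma geo_fixed (φ : X → X) (hφ : Isometry φ) (x y : X) (hx : φ x = x) (hy : φ y = y) (t : ℝ) :
    φ (geo x y t) = geo x y t := by
  obtain ⟨γ, h, e⟩ := geo_spec x y
  have h1 := geo_dist_left x y t
  have h2 := geo_dist_right x y t
  rw [e t]
  refine geod_unique x y _ γ h _ (Set.projIcc (0:ℝ) 1 zero_le_one t).2 ?_ ?_
  · rw [← e]
    have := hφ.dist_eq (geo x y t) x
    rw [hx] at this
    rw [this, h1]
  · rw [← e]
    have := hφ.dist_eq (geo x y t) y
    rw [hy] at this
    rw [this, h2]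

lemma geo_continuous {Z : Type*} [TopologicalSpace Z] (a b : Z → X) (t : Z → ℝ)
    (ha : Continuous a) (hb : Continuous b) (ht : Continuous t) :
    Continuous (fun z => geo (a z) (b z) (t z)) := by
  rw [continuous_iff_continuousAt]
  intro z0
  rw [ContinuousAt, tendsto_iff_dist_tendsto_zero]
  set P : Z → ℝ := fun z => (Set.projIcc (0:ℝ) 1 zero_le_one (t z) : ℝ) with hP
  have hPc : Continuous P := continuous_subtype_val.comp (continuous_projIcc.comp ht)
  set R : Z → ℝ := fun z => (1 - P z0) * (P z * dist (a z) (b z) + dist (a z) (a z0)) ^ 2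
    + P z0 * ((1 - P z) * dist (a z) (b z) + dist (b z) (b z0)) ^ 2
    - P z0 * (1 - P z0) * dist (a z0) (b z0) ^ 2 with hR
  have hRc : Continuous R := by rw [hR]; fun_prop
  have hR0 : R z0 = 0 := by simp only [hR, dist_self]; ring
  have hb : ∀ z, dist (geo (a z) (b z) (t z)) (geo (a z0) (b z0) (t z0)) ^ 2 ≤ R z := by
    intro z
    have h1 := geo_cn (geo (a z) (b z) (t z)) (a z0) (b z0) (t z0)
    have h2 : dist (geo (a z) (b z) (t z)) (a z0) ≤ P z * dist (a z) (b z) + dist (a z) (a z0) := by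
      rw [hP, ← geo_dist_left]; exact dist_triangle _ _ _
    have h3 : dist (geo (a z) (b z) (t z)) (b z0)
        ≤ (1 - P z) * dist (a z) (b z) + dist (b z) (b z0) := by
      rw [hP, ← geo_dist_right]; exact dist_triangle _ _ _
    have hp := (Set.projIcc (0:ℝ) 1 zero_le_one (t z0)).2
    have h4 := pow_le_pow_left₀ dist_nonneg h2 2
    have h5 := pow_le_pow_left₀ dist_nonneg h3 2
    refine h1.trans ?_
    have h6 := mul_le_mul_of_nonneg_left h4 (sub_nonneg.mpr hp.2)
    have h7 := mul_le_mul_of_nonneg_left h5 hp.1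
    simp only [hR]
    simp only [hP] at *
    linarith
  have hlim : Filter.Tendsto (fun z => Real.sqrt (R z)) (nhds z0) (nhds 0) := by
    have := (Real.continuous_sqrt.comp hRc).tendsto z0
    simpa [hR0, Function.comp_def] using this
  refine squeeze_zero (fun _ => dist_nonneg) (fun z => ?_) hlim
  exact Real.le_sqrt_of_sq_le (hb z)

lemma exists_mid (x y : X) : dist x (geo x y (1/2)) = dist x y / 2 ∧
    dist y (geo x y (1/2)) = dist x y / 2 := by
  have h1 := geo_dist_left x y (1/2)
  have h2 := geo_dist_right x y (1/2)
  rw [Set.projIcc_of_mem zero_le_one (x := (1/2:ℝ)) ⟨by norm_num, by norm_num⟩] at h1 h2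
  rw [dist_comm x, dist_comm y, h1, h2]
  constructor <;> ring

/-- Strongly convex functions have unique minimizers on closed convex sets. -/
lemma exists_min [CompleteSpace X] (C : Set X) (hC : IsClosed C) (hne : C.Nonempty)
    (hconv : ∀ x ∈ C, ∀ y ∈ C, ∀ t, geo x y t ∈ C) (F : X → ℝ) (hF : Continuous F)
    (hF0 : ∀ x, 0 ≤ F x)
    (hcn : ∀ y z m : X, dist y m = dist y z / 2 → dist z m = dist y z / 2 →
      F m ≤ (F y + F z) / 2 - dist y z ^ 2 / 4) :
    ∃ q ∈ C, ∀ r ∈ C, F r ≤ F q → r = q := by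
  set I := sInf (F '' C) with hI
  have hbdd : BddBelow (F '' C) := ⟨0, by rintro _ ⟨x, _, rfl⟩; exact hF0 x⟩
  have hIle : ∀ x ∈ C, I ≤ F x := fun x hx => csInf_le hbdd ⟨x, hx, rfl⟩
  have key : ∀ y ∈ C, ∀ z ∈ C, dist y z ^ 2 ≤ 2 * (F y - I) + 2 * (F z - I) := by
    intro y hy z hz
    obtain ⟨h1, h2⟩ := exists_mid y z
    have := hcn y z _ h1 h2
    have := hIle _ (hconv y hy z hz (1/2))
    linarith
  have hex : ∀ n : ℕ, ∃ x ∈ C, F x < I + 1 / ((n:ℝ) + 1) := by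
    intro n
    have hpos : (0:ℝ) < 1 / ((n:ℝ) + 1) := by positivity
    obtain ⟨_, ⟨x, hx, rfl⟩, h⟩ := exists_lt_of_csInf_lt (hne.image F)
      (show sInf (F '' C) < I + 1 / ((n:ℝ) + 1) by linarith)
    exact ⟨x, hx, h⟩
  choose u huC hu using hex
  have hcau : CauchySeq u := by
    rw [Metric.cauchySeq_iff]
    intro ε hε
    obtain ⟨N, hN⟩ := exists_nat_one_div_lt (show (0:ℝ) < ε ^ 2 / 4 by positivity)
    refine ⟨N, fun m hm n hn => ?_⟩
    have h1 := key _ (huC m) _ (huC n)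
    have h2 := hu m
    have h3 := hu n
    have h4 : 1 / ((m:ℝ) + 1) ≤ 1 / ((N:ℝ) + 1) := Nat.one_div_le_one_div hm
    have h5 : 1 / ((n:ℝ) + 1) ≤ 1 / ((N:ℝ) + 1) := Nat.one_div_le_one_div hn
    have : dist (u m) (u n) ^ 2 < ε ^ 2 := by linarith
    exact lt_of_pow_lt_pow_left₀ 2 hε.le this
  obtain ⟨q, hq⟩ := cauchySeq_tendsto_of_complete hcau
  have hqC : q ∈ C := hC.mem_of_tendsto hq (Filter.Eventually.of_forall huC)
  have hFq : F q ≤ I := by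
    have h1 := (hF.tendsto q).comp hq
    have h2 : Filter.Tendsto (fun n : ℕ => I + 1 / ((n:ℝ) + 1)) Filter.atTop (nhds (I + 0)) :=
      tendsto_const_nhds.add tendsto_one_div_add_atTop_nhds_zero_nat
    rw [add_zero] at h2
    exact le_of_tendsto_of_tendsto' h1 h2 fun n => (hu n).le
  refine ⟨q, hqC, fun r hr hle => ?_⟩
  have h1 := key r hr q hqC
  have h2 : dist r q ^ 2 ≤ 0 := by linarith
  have : dist r q = 0 := pow_eq_zero_iff two_ne_zero |>.mp (le_antisymm h2 (sq_nonneg _))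
  exact dist_eq_zero.mp this

lemma finOrder_fixed [CompleteSpace X] [Nonempty X] {G : Type} [Group G] [MulAction G X]
    (hiso : ∀ g : G, Isometry (fun x : X => g • x)) (g : G) (hg : IsOfFinOrder g) :
    ∃ x : X, g • x = x := by
  obtain ⟨x0⟩ := ‹Nonempty X›
  have hpos := hg.orderOf_pos
  set N := orderOf g with hN
  set F : X → ℝ := fun x => ∑ k ∈ Finset.range N, dist x (g ^ k • x0) ^ 2 with hFd
  obtain ⟨q, _, hq⟩ := exists_min (Set.univ : Set X) isClosed_univ ⟨x0, trivial⟩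
    (fun _ _ _ _ _ => trivial) F (by rw [hFd]; fun_prop)
    (fun x => Finset.sum_nonneg fun k _ => sq_nonneg _) (by
      intro y z m h1 h2
      have : F m ≤ ∑ k ∈ Finset.range N, ((dist y (g ^ k • x0) ^ 2 + dist z (g ^ k • x0) ^ 2) / 2
          - dist y z ^ 2 / 4) := by
        refine Finset.sum_le_sum fun k _ => ?_
        have := CAT0Space.cn (g ^ k • x0) y z m h1 h2
        simpa only [dist_comm (g ^ k • x0)] using this
      rw [Finset.sum_sub_distrib, ← Finset.sum_div, Finset.sum_add_distrib, Finset.sum_const,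
        Finset.card_range, nsmul_eq_mul] at this
      have hN1 : (1:ℝ) ≤ N := by exact_mod_cast hpos
      have h3 : dist y z ^ 2 / 4 ≤ N * (dist y z ^ 2 / 4) :=
        le_mul_of_one_le_left (by positivity) hN1
      simp only [hFd] at *
      linarith)
  refine ⟨q, hq _ trivial (le_of_eq ?_)⟩
  simp only [hFd]
  have e : ∀ k, dist (g • q) (g ^ (k+1) • x0) = dist q (g ^ k • x0) := by
    intro k
    rw [pow_succ', mul_smul]
    exact (hiso g).dist_eq _ _
  have s1 := Finset.sum_range_succ (fun k => dist (g • q) (g ^ k • x0) ^ 2) N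
  have s2 := Finset.sum_range_succ' (fun k => dist (g • q) (g ^ k • x0) ^ 2) N
  simp_rw [e] at s2
  rw [s1, hN, pow_orderOf_eq_one, pow_zero] at s2
  exact add_right_cancel s2

lemma cube_map : ∀ (d : ℕ) (v : (Fin d → Bool) → X), ∃ f : (Fin d → ℝ) → X, Continuous f ∧
    ∀ C : Set X, (∀ x ∈ C, ∀ y ∈ C, ∀ t, geo x y t ∈ C) →
      ((∀ e, v e ∈ C) → ∀ t, f t ∈ C) ∧
      (∀ i, (∀ e, e i = false → v e ∈ C) → ∀ t, t i = 0 → f t ∈ C) ∧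
      (∀ i, (∀ e, e i = true → v e ∈ C) → ∀ t, t i = 1 → f t ∈ C) := by
  intro d
  induction d with
  | zero =>
    intro v
    refine ⟨fun _ => v default, continuous_const, fun C hC => ⟨fun h t => h _, fun i => i.elim0,
      fun i => i.elim0⟩⟩
  | succ d ih =>
    intro v
    obtain ⟨f0, c0, h0⟩ := ih (fun e => v (Fin.cons false e))
    obtain ⟨f1, c1, h1⟩ := ih (fun e => v (Fin.cons true e))
    refine ⟨fun t => geo (f0 (Fin.tail t)) (f1 (Fin.tail t)) (t 0), ?_, fun C hC => ⟨?_, ?_, ?_⟩⟩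
    · have ht : Continuous (fun t : Fin (d+1) → ℝ => (Fin.tail t : Fin d → ℝ)) :=
        continuous_pi fun i => continuous_apply i.succ
      exact geo_continuous _ _ _ (c0.comp ht) (c1.comp ht) (continuous_apply 0)
    · intro h t
      exact hC _ ((h0 C hC).1 (fun e => h _) _) _ ((h1 C hC).1 (fun e => h _) _) _
    · intro i
      refine Fin.cases ?_ (fun i => ?_) i
      · intro h t ht
        simp only [ht, geo_zero]
        exact (h0 C hC).1 (fun e => h _ (by simp)) _
      · intro h t ht
        exact hC _ ((h0 C hC).2.1 i (fun e he => h _ (by simpa using he)) _ ht) _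
          ((h1 C hC).2.1 i (fun e he => h _ (by simpa using he)) _ ht) _
    · intro i
      refine Fin.cases ?_ (fun i => ?_) i
      · intro h t ht
        simp only [ht, geo_one]
        exact (h1 C hC).1 (fun e => h _ (by simp)) _
      · intro h t ht
        exact hC _ ((h0 C hC).2.2 i (fun e he => h _ (by simpa using he)) _ ht) _
          ((h1 C hC).2.2 i (fun e he => h _ (by simpa using he)) _ ht) _

end CATZero

theorem cube_cover {X : Type} [TopologicalSpace X] {d d' : ℕ} (hdim : CoveringDimLE X d')
    (hlt : d' < d) (P Q : Fin d → Set X) (hP : ∀ i, IsClosed (P i)) (hQ : ∀ i, IsClosed (Q i))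
    (hPQ : ∀ i x, x ∈ P i → x ∉ Q i) (f : (Fin d → ℝ) → X) (hf : Continuous f)
    (hf0 : ∀ i t, t i = 0 → f t ∈ P i) (hf1 : ∀ i t, t i = 1 → f t ∈ Q i) : False := by
  classical
  obtain ⟨κ, V, hVo, hVc, hVU, hVn⟩ := hdim (Fin d → Bool)
    (fun e => ⋂ i, if e i then (P i)ᶜ else (Q i)ᶜ)
    (by
      intro e
      refine isOpen_iInter_of_finite fun i => ?_
      split_ifs
      · exact (hP i).isOpen_compl
      · exact (hQ i).isOpen_compl)
    (by
      rw [Set.eq_univ_iff_forall]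
      intro x
      rw [Set.mem_iUnion]
      refine ⟨fun i => decide (x ∉ P i), ?_⟩
      rw [Set.mem_iInter]
      intro i
      by_cases h : x ∈ P i
      · simpa [h] using hPQ i x h
      · simp [h])
  have hsep : ∀ j i x y, x ∈ V j → y ∈ V j → x ∈ P i → y ∈ Q i → False := by
    intro j i x y hx hy hxP hyQ
    obtain ⟨e, he⟩ := hVU j
    have h1 := Set.mem_iInter.mp (he hx) i
    have h2 := Set.mem_iInter.mp (he hy) i
    cases h : e i <;> simp [h] at h1 h2
    · exact h2 hyQ
    · exact h1 hxP
  obtain ⟨δ, hδ, hleb⟩ := lebesgue_number_lemma_of_metric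
    (isCompact_Icc (a := (0 : Fin d → ℝ)) (b := 1)) (c := fun j => f ⁻¹' V j)
    (fun j => (hVo j).preimage hf) (by
      intro t _
      have : f t ∈ ⋃ j, V j := by rw [hVc]; trivial
      simpa using this)
  obtain ⟨m, hm⟩ := exists_nat_one_div_lt hδ
  set n := m + 1 with hn
  have hn0 : (0:ℝ) < n := by positivity
  set pt : (Fin d → ℕ) → (Fin d → ℝ) := fun x i => (x i : ℝ) / n with hpt
  have hmem : ∀ x : Fin d → ℕ, (∀ i, x i ≤ n) → pt x ∈ Set.Icc (0 : Fin d → ℝ) 1 := by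
    intro x hx
    refine ⟨fun i => ?_, fun i => ?_⟩
    · simp only [hpt, Pi.zero_apply]; positivity
    · simp only [hpt, Pi.one_apply]
      rw [div_le_one hn0]
      exact_mod_cast hx i
  have hch : ∀ x : Fin d → ℕ, ∃ j, (∀ i, x i ≤ n) → Metric.ball (pt x) δ ⊆ f ⁻¹' V j := by
    intro x
    by_cases hx : ∀ i, x i ≤ n
    · obtain ⟨j, hj⟩ := hleb _ (hmem x hx)
      exact ⟨j, fun _ => hj⟩
    · have h0 : (0 : Fin d → ℝ) ∈ Set.Icc (0 : Fin d → ℝ) 1 := ⟨le_refl _, zero_le_one⟩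
      obtain ⟨j, _⟩ := hleb _ h0
      exact ⟨j, fun h => absurd h hx⟩
  choose J hJ using hch
  -- label of a member of the cover: the first coordinate whose `Q`-face it misses
  have hlab : ∀ j : κ, ∃ l : ℕ, l ≤ d ∧ (∀ i : Fin d, (i : ℕ) < l → (V j ∩ Q i).Nonempty) ∧
      (∀ i : Fin d, (i : ℕ) = l → ¬ (V j ∩ Q i).Nonempty) := by
    intro j
    have hex : ∃ l : ℕ, l = d ∨ ∃ h : l < d, ¬ (V j ∩ Q ⟨l, h⟩).Nonempty := ⟨d, Or.inl rfl⟩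
    refine ⟨Nat.find hex, Nat.find_min' hex (Or.inl rfl), ?_, ?_⟩
    · intro i hi
      have := Nat.find_min hex hi
      push Not at this
      exact this.2 i.2
    · intro i hi
      rcases Nat.find_spec hex with h | ⟨h, h'⟩
      · have := i.2; omega
      · have : i = ⟨Nat.find hex, h⟩ := Fin.ext hi
        rw [this]; exact h'
  choose lab hlab0 hlab1 hlab2 using hlab
  have hself : ∀ x : Fin d → ℕ, (∀ i, x i ≤ n) → f (pt x) ∈ V (J x) := fun x hx =>
    hJ x hx (Metric.mem_ball_self hδ)
  obtain ⟨v, hv1, hv2, hv3⟩ := kuhn_lemma n (Nat.succ_pos m) d (fun x => lab (J x))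
    (fun x _ => hlab0 _)
    (by
      intro x i hx hi
      by_contra hcon
      obtain ⟨y, hy1, hy2⟩ := hlab1 (J x) i (not_le.mp hcon)
      refine hsep _ i _ _ (hself x hx) hy1 (hf0 i _ ?_) hy2
      simp [hpt, hi])
    (by
      intro x i hx hi hcon
      refine hlab2 (J x) i hcon.symm ⟨_, hself x hx, hf1 i _ ?_⟩
      simp only [hpt, hi]
      exact div_self hn0.ne')
  have hinj : Function.Injective (fun k => J (v k)) := by
    intro a b hab
    exact hv3 (congrArg lab hab)
  have hall : ∀ k, f (pt (v 0)) ∈ V (J (v k)) := by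
    intro k
    apply hJ (v k) (hv1 k)
    rw [Metric.mem_ball, dist_pi_lt_iff hδ]
    intro i
    refine lt_of_le_of_lt ?_ hm
    simp only [hpt, Real.dist_eq]
    rw [← sub_div, abs_div, abs_of_pos hn0]
    have hcast : ((m:ℝ) + 1) = n := by rw [hn]; push_cast; ring
    rw [hcast]
    apply div_le_div_of_nonneg_right _ hn0.le
    have a1 : (v 0 i : ℝ) ≤ v k i + 1 := by exact_mod_cast hv2 0 k i
    have a2 : (v k i : ℝ) ≤ v 0 i + 1 := by exact_mod_cast hv2 k 0 i
    rw [abs_le]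
    constructor <;> linarith
  obtain ⟨hfin, hcard⟩ := hVn (f (pt (v 0)))
  have h1 : (Set.range (fun k => J (v k))).ncard = d + 1 := by
    rw [← Set.image_univ, Set.ncard_image_of_injective _ hinj, Set.ncard_univ]
    simp
  have h2 := Set.ncard_le_ncard (s := Set.range (fun k => J (v k))) (by
    rintro _ ⟨k, rfl⟩
    exact hall k) hfin
  omega

section Action
variable {d : ℕ} {Γ : Fin d → Type} [∀ i, Group (Γ i)] {X : Type} [MetricSpace X]
  [CAT0Space X] [MulAction (∀ i, Γ i) X]

/-- Common fixed points of a set of elements of one factor. -/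
def fixS (X : Type) [MulAction (∀ i, Γ i) X] (i : Fin d) (R : Set (Γ i)) : Set X :=
  {x | ∀ g ∈ R, (Pi.mulSingle i g : ∀ i, Γ i) • x = x}

lemma mem_fixS {i : Fin d} {R : Set (Γ i)} {x : X} :
    x ∈ fixS X i R ↔ ∀ g ∈ R, (Pi.mulSingle i g : ∀ i, Γ i) • x = x := Iff.rfl

lemma fixS_closed (hiso : ∀ g : ∀ i, Γ i, Isometry (fun x : X => g • x)) (i : Fin d)
    (R : Set (Γ i)) : IsClosed (fixS X i R) := by
  have : fixS X i R = ⋂ g ∈ R, {x : X | (Pi.mulSingle i g : ∀ i, Γ i) • x = x} := by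
    ext x; simp [mem_fixS]
  rw [this]
  exact isClosed_biInter fun g _ => isClosed_eq (hiso _).continuous continuous_id

lemma fixS_convex (hiso : ∀ g : ∀ i, Γ i, Isometry (fun x : X => g • x)) (i : Fin d)
    (R : Set (Γ i)) : ∀ x ∈ fixS X i R, ∀ y ∈ fixS X i R, ∀ t, geo x y t ∈ fixS X i R := by
  intro x hx y hy t g hg
  exact geo_fixed _ (hiso (Pi.mulSingle i g)) x y (hx g hg) (hy g hg) t

lemma common_fix [CompleteSpace X] [Nonempty X]
    (hiso : ∀ g : ∀ i, Γ i, Isometry (fun x : X => g • x))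
    (R : ∀ i, Set (Γ i)) (hR : ∀ i, (fixS X i (R i)).Nonempty) (s : Finset (Fin d)) :
    ∃ x : X, ∀ i ∈ s, x ∈ fixS X i (R i) := by
  induction s using Finset.induction_on with
  | empty => exact ⟨Classical.arbitrary X, by simp⟩
  | insert j s hj ih =>
    obtain ⟨p, hp⟩ := ih
    obtain ⟨q, hqC, hq⟩ := exists_min (fixS X j (R j)) (fixS_closed hiso j _) (hR j)
      (fixS_convex hiso j _) (fun x => dist p x ^ 2) (by fun_prop) (fun x => sq_nonneg _)
      (fun y z m h1 h2 => CAT0Space.cn p y z m h1 h2)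
    refine ⟨q, fun i hi => ?_⟩
    rcases Finset.mem_insert.mp hi with rfl | his
    · exact hqC
    · intro g hg
      have hij : i ≠ j := by rintro rfl; exact hj his
      apply hq
      · intro h hh
        rw [← mul_smul, ← (Pi.mulSingle_commute hij g h).eq, mul_smul, hqC h hh]
      · have h1 := (hiso (Pi.mulSingle i g)).dist_eq p q
        rw [hp i his g hg] at h1
        rw [h1]

lemma split_fix [CompleteSpace X] [Nonempty X]
    (hiso : ∀ g : ∀ i, Γ i, Isometry (fun x : X => g • x)) (i : Fin d) (T : Finset (Γ i))
    (hT : ∀ g ∈ T, IsOfFinOrder g) :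
    (fixS X i (T : Set (Γ i))).Nonempty ∨ ∃ R0 R1 : Set (Γ i), (fixS X i R0).Nonempty ∧
      (fixS X i R1).Nonempty ∧ ∀ x, x ∈ fixS X i R0 → x ∉ fixS X i R1 := by
  classical
  induction T using Finset.induction_on with
  | empty => exact Or.inl ⟨Classical.arbitrary X, by simp [mem_fixS]⟩
  | insert t M ht ih =>
    rcases ih (fun g hg => hT g (Finset.mem_insert_of_mem hg)) with h | h
    · by_cases hne : (fixS X i ((insert t M : Finset (Γ i)) : Set (Γ i))).Nonempty
      · exact Or.inl hne
      · right
        refine ⟨M, {t}, h, ?_, ?_⟩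
        · have hfo : IsOfFinOrder (Pi.mulSingle i t : ∀ i, Γ i) :=
            (MonoidHom.mulSingle Γ i).isOfFinOrder (hT t (Finset.mem_insert_self _ _))
          obtain ⟨x, hx⟩ := finOrder_fixed hiso _ hfo
          exact ⟨x, by simpa [mem_fixS] using hx⟩
        · intro x hx hx'
          apply hne
          refine ⟨x, fun g hg => ?_⟩
          rw [Finset.coe_insert] at hg
          rcases hg with rfl | hg
          · exact hx' _ rfl
          · exact hx g hg
    · exact Or.inr h

end Action

/-- Product Lemma with torsion: if each of d groups is generated by finitely many elements of
finite order, then in any isometric action of their direct product on a complete CAT(0)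
space of dimension less than d, some factor has a global fixed point. -/
theorem product_lemma_torsion {d : ℕ} (Γ : Fin d → Type) [∀ i, Group (Γ i)]
    (hgen : ∀ i, ∃ T : Finset (Γ i), (∀ g ∈ T, IsOfFinOrder g) ∧
      Subgroup.closure (T : Set (Γ i)) = ⊤)
    {X : Type} [MetricSpace X] [CompleteSpace X] [CAT0Space X] [Nonempty X]
    [MulAction (∀ i, Γ i) X] (hiso : ∀ g : ∀ i, Γ i, Isometry (fun x : X => g • x))
    {d' : ℕ} (hdim : CoveringDimLE X d') (hlt : d' < d) :
    ∃ i, ∃ x : X, ∀ g : Γ i, Pi.mulSingle i g • x = x := by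
  by_contra hno
  push Not at hno
  have key : ∀ i, ∃ R0 R1 : Set (Γ i), (fixS X i R0).Nonempty ∧
      (fixS X i R1).Nonempty ∧ ∀ x, x ∈ fixS X i R0 → x ∉ fixS X i R1 := by
    intro i
    obtain ⟨T, hT, hcl⟩ := hgen i
    rcases split_fix hiso i T hT with ⟨x, hx⟩ | h
    · exfalso
      obtain ⟨g, hg⟩ := hno i x
      have hle : Subgroup.closure (T : Set (Γ i)) ≤
          (MulAction.stabilizer (∀ i, Γ i) x).comap (MonoidHom.mulSingle Γ i) := by
        rw [Subgroup.closure_le]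
        intro h hh
        exact hx h hh
      rw [hcl] at hle
      exact hg (hle (Subgroup.mem_top g))
    · exact h
  choose R0 R1 h0 h1 hdis using key
  have hv : ∀ e : Fin d → Bool, ∃ x : X, ∀ i, x ∈ fixS X i (if e i then R1 i else R0 i) := by
    intro e
    obtain ⟨x, hx⟩ := common_fix hiso (fun i => if e i then R1 i else R0 i) (by
      intro i
      split_ifs
      · exact h1 i
      · exact h0 i) Finset.univ
    exact ⟨x, fun i => hx i (Finset.mem_univ i)⟩
  choose v hv using hv
  obtain ⟨f, hf, hfC⟩ := cube_map d v
  refine cube_cover hdim hlt (fun i => fixS X i (R0 i)) (fun i => fixS X i (R1 i))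
    (fun i => fixS_closed hiso i _) (fun i => fixS_closed hiso i _) hdis f hf ?_ ?_
  · intro i
    refine (hfC _ (fixS_convex hiso i _)).2.1 i fun e he => ?_
    simpa [he] using hv e i
  · intro i
    refine (hfC _ (fixS_convex hiso i _)).2.2 i fun e he => ?_
    simpa [he] using hv e i
end

section
/- For each n ≥ 1 there is a group Γ_n acting properly and cocompactly by isometries on Euclidean n-space such that Γ_n has a global fixed point whenever it acts by isometries on a complete CAT(0) space of dimension less than n; one may take Γ_n = D_∞ ≀ C_n, the wreath product of the infinite dihedral group with the cyclic group of order n. -/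
/-- The shift action of the cyclic group C_d = ZMod d on the direct product of d copies
of Γ, permuting the coordinates. -/
def shiftHom (Γ : Type) [Group Γ] (d : ℕ) :
    Multiplicative (ZMod d) →* MulAut (ZMod d → Γ) where
  toFun t :=
    { toFun := fun f s => f (s - Multiplicative.toAdd t)
      invFun := fun f s => f (s + Multiplicative.toAdd t)
      left_inv := fun f => funext fun s => by simp
      right_inv := fun f => funext fun s => by simp
      map_mul' := fun f g => rfl }
  map_one' := by
    ext f s
    simp
  map_mul' a b := by
    ext f s
    simp [sub_sub]

/-- The wreath product Γ ≀ C_d of Γ with the cyclic group of order d; since C_d is finite,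
the restricted and unrestricted wreath products coincide. -/
def WreathCd (Γ : Type) [Group Γ] (d : ℕ) : Type :=
  (ZMod d → Γ) ⋊[shiftHom Γ d] Multiplicative (ZMod d)

instance (Γ : Type) [Group Γ] (d : ℕ) : Group (WreathCd Γ d) :=
  inferInstanceAs (Group ((ZMod d → Γ) ⋊[shiftHom Γ d] Multiplicative (ZMod d)))

/-- Kuhn simplices of the grid: base point and order of the steps. -/
def kuhnT (n N : ℕ) : Finset ((Fin n → ℕ) × (Fin n → ℕ)) :=
  {x ∈ (Fintype.piFinset fun _ => Finset.range N) ×ˢ (Fintype.piFinset fun _ => Finset.range n) |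
    Function.Injective x.2}

/-- The `k`-th vertex. -/
def kuhnV {n : ℕ} (x : (Fin n → ℕ) × (Fin n → ℕ)) (k : ℕ) : Fin n → ℕ :=
  fun i => x.1 i + if x.2 i < k then 1 else 0

theorem mem_kuhnT {n N : ℕ} {x : (Fin n → ℕ) × (Fin n → ℕ)} :
    x ∈ kuhnT n N ↔ (∀ i, x.1 i < N) ∧ (∀ i, x.2 i < n) ∧ Function.Injective x.2 := by
  simp [kuhnT, Fintype.mem_piFinset, and_assoc]

theorem kuhn_surj {n : ℕ} {s : Fin n → ℕ} (h : ∀ i, s i < n) (hi : Function.Injective s)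
    (c : ℕ) (hc : c < n) : ∃ i, s i = c := by
  have h1 : Function.Injective (fun i => (⟨s i, h i⟩ : Fin n)) := by
    intro a b hab
    exact hi (by simpa using hab)
  obtain ⟨i, hi⟩ := (Finite.surjective_of_injective h1) ⟨c, hc⟩
  exact ⟨i, by simpa using hi⟩

theorem kuhnV_le {n N : ℕ} {x : (Fin n → ℕ) × (Fin n → ℕ)} (hx : x ∈ kuhnT n N) (k : ℕ) (i : Fin n) :
    kuhnV x k i ≤ N := by
  have := (mem_kuhnT.1 hx).1 i
  unfold kuhnV
  split_ifs <;> omega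

open Classical in
theorem door_parity (m : ℕ) (g : ℕ → ℕ) (hg : ∀ k ≤ m + 1, g k ≤ m + 1) :
    ((Finset.card {k ∈ Finset.range (m + 2) | ∀ c ≤ m, ∃ j ≤ m + 1, j ≠ k ∧ g j = c} : ℕ) : ZMod 2)
      = if (∀ c ≤ m + 1, ∃ k ≤ m + 1, g k = c) then 1 else 0 := by
  by_cases h1 : ∀ c ≤ m, ∃ k ≤ m + 1, g k = c
  swap
  · have h2 : ¬ (∀ c ≤ m + 1, ∃ k ≤ m + 1, g k = c) := fun h => h1 fun c hc => h c (by omega)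
    rw [if_neg h2, Finset.filter_false_of_mem]
    · simp
    · intro k _ h
      exact h1 fun c hc => by
        obtain ⟨j, hj, _, e⟩ := h c hc
        exact ⟨j, hj, e⟩
  by_cases h2 : ∃ k ≤ m + 1, g k = m + 1
  · have h3 : (∀ c ≤ m + 1, ∃ k ≤ m + 1, g k = c) := by
      intro c hc
      rcases Nat.lt_or_ge m c with h | h
      · obtain rfl : c = m + 1 := by omega
        exact h2
      · exact h1 c h
    rw [if_pos h3]
    obtain ⟨k0, hk0, e0⟩ := h2
    have hinj : Set.InjOn g (Finset.range (m + 2) : Finset ℕ) := by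
      apply Finset.injOn_of_surjOn_of_card_le (t := Finset.range (m + 2))
      · intro k hk
        have := hg k (by simp at hk; omega)
        simp; omega
      · intro c hc
        obtain ⟨k, hk, e⟩ := h3 c (by simp at hc; omega)
        exact ⟨k, by simp; omega, e⟩
      · simp
    have : {k ∈ Finset.range (m + 2) | ∀ c ≤ m, ∃ j ≤ m + 1, j ≠ k ∧ g j = c} = {k0} := by
      ext k
      simp only [Finset.mem_filter, Finset.mem_range, Finset.mem_singleton]
      constructor
      · rintro ⟨hk, h⟩
        by_contra hne
        have hgk := hg k (by omega)
        have : g k ≠ m + 1 := fun e => hne (hinj (by simp; omega) (by simp; omega) (e.trans e0.symm))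
        obtain ⟨j, hj, hjk, e⟩ := h (g k) (by omega)
        exact hjk (hinj (by simp; omega) (by simp; omega) e)
      · rintro rfl
        refine ⟨by omega, fun c hc => ?_⟩
        obtain ⟨j, hj, e⟩ := h1 c hc
        refine ⟨j, hj, ?_, e⟩
        rintro rfl
        omega
    rw [this]; simp
  · have h3 : ¬ (∀ c ≤ m + 1, ∃ k ≤ m + 1, g k = c) := fun h => h2 (h _ le_rfl)
    rw [if_neg h3]
    have hg' : ∀ k ≤ m + 1, g k ≤ m := fun k hk => by
      have := hg k hk
      have : g k ≠ m + 1 := fun e => h2 ⟨k, hk, e⟩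
      omega
    obtain ⟨a, ha, b, hb, hab, e⟩ := Finset.exists_ne_map_eq_of_card_lt_of_maps_to
      (s := Finset.range (m + 2)) (t := Finset.range (m + 1)) (f := g) (by simp) (by
        intro k hk
        have := hg' k (by simp at hk; omega)
        simp; omega)
    simp only [Finset.mem_range] at ha hb
    have : {k ∈ Finset.range (m + 2) | ∀ c ≤ m, ∃ j ≤ m + 1, j ≠ k ∧ g j = c} = {a, b} := by
      ext k
      simp only [Finset.mem_filter, Finset.mem_range, Finset.mem_singleton, Finset.mem_insert]
      constructor
      · rintro ⟨hk, h⟩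
        by_contra hne
        push Not at hne
        have hc : (Finset.range (m + 1)).card ≤ (((Finset.range (m + 2)).erase k).erase a).card := by
          apply Finset.card_le_card_of_surjOn g
          intro c hc
          obtain ⟨j, hj, hjk, e'⟩ := h c (by simp at hc; omega)
          by_cases hja : j = a
          · exact ⟨b, by simp; omega, by rw [← e, ← hja, e']⟩
          · exact ⟨j, by simp; omega, e'⟩
        rw [Finset.card_erase_of_mem (by simp; omega), Finset.card_erase_of_mem (by simp; omega)] at hc
        simp at hc
      · intro hk
        refine ⟨by omega, fun c hc => ?_⟩
        obtain ⟨j, hj, e'⟩ := h1 c hc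
        by_cases hjk : j = k
        · rcases hk with rfl | rfl
          · exact ⟨b, by omega, Ne.symm hab, by rw [← e, ← hjk, e']⟩
          · exact ⟨a, by omega, hab, by rw [e, ← hjk, e']⟩
        · exact ⟨j, hj, hjk, e'⟩
    rw [this, Finset.card_pair hab]
    rfl

open Classical in
theorem sperner_cube (n N : ℕ) (hN : 1 ≤ N) (L : (Fin n → ℕ) → ℕ)
    (h0 : ∀ q, (∀ i, q i ≤ N) → L q ≤ n)
    (h1 : ∀ q, (∀ i, q i ≤ N) → ∀ i : Fin n, q i = 0 → L q ≤ i)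
    (h2 : ∀ q, (∀ i, q i ≤ N) → ∀ i : Fin n, q i = N → L q ≠ i) :
    ((Finset.card {x ∈ kuhnT n N | ∀ c ≤ n, ∃ k ≤ n, L (kuhnV x k) = c} : ℕ) : ZMod 2) = 1 := by
  induction n with
  | zero =>
    refine Eq.trans (congrArg (fun s : Finset _ => (s.card : ZMod 2))
      (?_ : _ = {(Fin.elim0, Fin.elim0)})) (by simp)
    · ext x
      simp only [Finset.mem_filter, mem_kuhnT, Finset.mem_singleton]
      constructor
      · intro _
        exact Subsingleton.elim _ _
      · rintro rfl
        refine ⟨⟨fun i => i.elim0, fun i => i.elim0, fun i => i.elim0⟩, fun c hc => ⟨0, le_rfl, ?_⟩⟩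
        have := h0 (kuhnV (Fin.elim0, Fin.elim0) 0) (fun i => i.elim0)
        omega
  | succ m ih =>
    set D : ℕ → Finset ((Fin (m+1) → ℕ) × (Fin (m+1) → ℕ)) := fun k =>
      {x ∈ kuhnT (m + 1) N | ∀ c ≤ m, ∃ j ≤ m + 1, j ≠ k ∧ L (kuhnV x j) = c} with hD
    have key : ((Finset.card {x ∈ kuhnT (m + 1) N | ∀ c ≤ m + 1, ∃ k ≤ m + 1, L (kuhnV x k) = c} : ℕ) : ZMod 2)
        = ∑ k ∈ Finset.range (m + 2), ((D k).card : ZMod 2) := by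
      rw [Finset.card_filter]
      push_cast
      have : ∀ k ∈ Finset.range (m + 2), ((D k).card : ZMod 2) = ∑ x ∈ kuhnT (m + 1) N,
          if (∀ c ≤ m, ∃ j ≤ m + 1, j ≠ k ∧ L (kuhnV x j) = c) then 1 else 0 := by
        intro k _
        rw [hD]
        simp only [Finset.card_filter]
        push_cast
        rfl
      rw [Finset.sum_congr rfl this, Finset.sum_comm]
      refine Finset.sum_congr rfl fun x hx => ?_
      rw [← door_parity m (fun k => L (kuhnV x k)) (fun k _ => h0 _ (kuhnV_le hx k)), Finset.card_filter]
      push_cast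
      rfl
    have mid : ∀ k ∈ Finset.Icc 1 m, ((D k).card : ZMod 2) = 0 := by
      intro k hk
      rw [Finset.mem_Icc] at hk
      have hv : ∀ x : (Fin (m+1) → ℕ) × (Fin (m+1) → ℕ), ∀ j, j ≠ k → kuhnV (x.1, fun i => if x.2 i = k then k - 1 else
          if x.2 i = k - 1 then k else x.2 i) j = kuhnV x j := by
        intro x j hj
        funext i
        simp only [kuhnV]
        congr 1
        split_ifs <;> omega
      rw [Finset.cast_card]
      refine Finset.sum_involution (fun x _ => (x.1, fun i => if x.2 i = k then k - 1 else
          if x.2 i = k - 1 then k else x.2 i)) ?_ ?_ ?_ ?_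
      · intro x hx; rfl
      · intro x hx _ he
        rw [hD, Finset.mem_filter, mem_kuhnT] at hx
        obtain ⟨i, hi⟩ := kuhn_surj hx.1.2.1 hx.1.2.2 k (by omega)
        have := congrFun (congrArg Prod.snd he) i
        simp [hi] at this
        omega
      · intro x hx
        rw [hD, Finset.mem_filter, mem_kuhnT] at hx ⊢
        refine ⟨⟨hx.1.1, ?_, ?_⟩, ?_⟩
        · intro i
          have := hx.1.2.1 i
          simp only
          split_ifs <;> omega
        · intro i j hij
          apply hx.1.2.2
          simp only at hij
          split_ifs at hij <;> omega
        · intro c hc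
          obtain ⟨j, hj, hjk, e⟩ := hx.2 c hc
          exact ⟨j, hj, hjk, by rw [hv x j hjk, e]⟩
      · intro x hx
        ext i
        · rfl
        · simp only
          split_ifs <;> omega
    have hpos : (D 0).card = (Finset.filter (fun x => ¬ ∃ i, x.2 i = m ∧ x.1 i = 0) (D (m + 1))).card := by
      refine Finset.card_nbij' (fun x => (fun i => x.1 i + if x.2 i = 0 then 1 else 0,
          fun i => if x.2 i = 0 then m else x.2 i - 1))
        (fun x => (fun i => x.1 i - if x.2 i = m then 1 else 0,
          fun i => if x.2 i = m then 0 else x.2 i + 1)) ?_ ?_ ?_ ?_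
      · intro x hx
        have hx : x ∈ D 0 := hx
        show _ ∈ (Finset.filter _ _)
        rw [hD, Finset.mem_filter] at hx
        obtain ⟨hxT, hx2⟩ := hx
        have hxT' := mem_kuhnT.1 hxT
        rw [Finset.mem_filter, hD, Finset.mem_filter, mem_kuhnT]
        refine ⟨⟨⟨?_, ?_, ?_⟩, ?_⟩, ?_⟩
        · intro i
          have hi := hxT'.1 i
          simp only
          split_ifs with h
          · by_contra hcon
            obtain ⟨j, hj, hj0, e⟩ := hx2 i (by omega)
            refine h2 _ (kuhnV_le hxT j) i ?_ e
            simp only [kuhnV, h]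
            rw [if_pos (by omega)]; omega
          · omega
        · intro i
          have := hxT'.2.1 i
          simp only
          split_ifs <;> omega
        · intro i j hij
          apply hxT'.2.2
          have := hxT'.2.1 i
          have := hxT'.2.1 j
          simp only at hij
          split_ifs at hij <;> omega
        · intro c hc
          obtain ⟨j, hj, hj0, e⟩ := hx2 c hc
          refine ⟨j - 1, by omega, by omega, ?_⟩
          rw [← e]
          congr 1
          funext i
          have := hxT'.2.1 i
          simp only [kuhnV]
          split_ifs <;> omega
        · rintro ⟨i, hi, hi'⟩
          have := hxT'.2.1 i
          simp only at hi hi'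
          split_ifs at hi hi' <;> omega
      · intro x hx
        have hx : x ∈ (Finset.filter (fun x => ¬ ∃ i, x.2 i = m ∧ x.1 i = 0) (D (m + 1))) := hx
        show _ ∈ D 0
        rw [Finset.mem_filter, hD, Finset.mem_filter] at hx
        obtain ⟨⟨hxT, hx2⟩, hx3⟩ := hx
        have hxT' := mem_kuhnT.1 hxT
        rw [hD, Finset.mem_filter, mem_kuhnT]
        refine ⟨⟨?_, ?_, ?_⟩, ?_⟩
        · intro i
          have hi := hxT'.1 i
          simp only
          split_ifs <;> omega
        · intro i
          have := hxT'.2.1 i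
          simp only
          split_ifs <;> omega
        · intro i j hij
          apply hxT'.2.2
          simp only at hij
          split_ifs at hij <;> omega
        · intro c hc
          obtain ⟨j, hj, hj0, e⟩ := hx2 c hc
          refine ⟨j + 1, by omega, by omega, ?_⟩
          rw [← e]
          congr 1
          funext i
          have := hxT'.2.1 i
          have h3 : x.2 i = m → x.1 i ≠ 0 := fun h h' => hx3 ⟨i, h, h'⟩
          simp only [kuhnV]
          split_ifs <;> omega
      · intro x hx
        have hx : x ∈ D 0 := hx
        rw [hD, Finset.mem_filter, mem_kuhnT] at hx
        ext i
        · have := hx.1.2.1 i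
          simp only
          split_ifs <;> omega
        · have := hx.1.2.1 i
          simp only
          split_ifs <;> omega
      · intro x hx
        have hx : x ∈ (Finset.filter (fun x => ¬ ∃ i, x.2 i = m ∧ x.1 i = 0) (D (m + 1))) := hx
        rw [Finset.mem_filter, hD, Finset.mem_filter, mem_kuhnT] at hx
        ext i
        · have h3 : x.2 i = m → x.1 i ≠ 0 := fun h h' => hx.2 ⟨i, h, h'⟩
          by_cases h : x.2 i = m
          · have := h3 h
            simp [h]; omega
          · simp [h]
        · by_cases h : x.2 i = m <;> simp [h]
    have hzero : (Finset.filter (fun x => ∃ i, x.2 i = m ∧ x.1 i = 0) (D (m + 1))).card =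
        (Finset.card {x ∈ kuhnT m N | ∀ c ≤ m, ∃ k ≤ m, L (Fin.snoc (kuhnV x k) 0) = c} : ℕ) := by
      have hlast : ∀ x ∈ (Finset.filter (fun x => ∃ i, x.2 i = m ∧ x.1 i = 0) (D (m + 1))),
          x.2 (Fin.last m) = m ∧ x.1 (Fin.last m) = 0 := by
        intro x hx
        rw [Finset.mem_filter, hD, Finset.mem_filter] at hx
        obtain ⟨⟨hxT, hx2⟩, i, hi, hi0⟩ := hx
        obtain ⟨j, hj, hj0, e⟩ := hx2 m le_rfl
        have := h1 _ (kuhnV_le hxT j) i (by simp only [kuhnV, hi, hi0]; split_ifs <;> omega)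
        have : i = Fin.last m := by
          apply Fin.ext
          simp only [Fin.val_last]
          omega
        subst this
        exact ⟨hi, hi0⟩
      have hsn : ∀ (x : (Fin (m+1) → ℕ) × (Fin (m+1) → ℕ)) k, k ≤ m → x.2 (Fin.last m) = m → x.1 (Fin.last m) = 0 →
          (Fin.snoc (kuhnV (fun i => x.1 (Fin.castSucc i), fun i => x.2 (Fin.castSucc i)) k) 0
            : Fin (m+1) → ℕ) = kuhnV x k := by
        intro x k hk hl hl0
        funext i
        refine Fin.lastCases ?_ (fun i => ?_) i
        · simp [kuhnV, hl, hl0]; omega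
        · simp [kuhnV]
      refine Finset.card_nbij' (fun x => (fun i => x.1 (Fin.castSucc i), fun i => x.2 (Fin.castSucc i)))
        (fun x => (Fin.snoc x.1 0, Fin.snoc x.2 m)) ?_ ?_ ?_ ?_
      · intro x hx
        obtain ⟨hl, hl0⟩ := hlast x hx
        have hx : x ∈ (Finset.filter (fun x => ∃ i, x.2 i = m ∧ x.1 i = 0) (D (m + 1))) := hx
        show _ ∈ (Finset.filter _ _)
        rw [Finset.mem_filter, hD, Finset.mem_filter] at hx
        obtain ⟨⟨hxT, hx2⟩, -⟩ := hx
        have hxT' := mem_kuhnT.1 hxT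
        rw [Finset.mem_filter, mem_kuhnT]
        refine ⟨⟨fun i => hxT'.1 _, fun i => ?_, ?_⟩, ?_⟩
        · have h3 := hxT'.2.1 (Fin.castSucc i)
          have h4 : x.2 (Fin.castSucc i) ≠ m := by
            intro h
            have := hxT'.2.2 (h.trans hl.symm)
            exact absurd this (Fin.castSucc_lt_last i).ne
          simp only
          omega
        · intro i j hij
          exact Fin.castSucc_injective _ (hxT'.2.2 hij)
        · intro c hc
          obtain ⟨j, hj, hj0, e⟩ := hx2 c hc
          exact ⟨j, by omega, by rw [hsn x j (by omega) hl hl0, e]⟩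
      · intro x hx
        have hx : x ∈ (Finset.filter _ _) := hx
        show _ ∈ (Finset.filter _ _)
        rw [Finset.mem_filter, mem_kuhnT] at hx
        rw [Finset.mem_filter, hD, Finset.mem_filter, mem_kuhnT]
        obtain ⟨⟨ha, hb, hc⟩, hd⟩ := hx
        refine ⟨⟨⟨?_, ?_, ?_⟩, ?_⟩, Fin.last m, by simp, by simp⟩
        · intro i
          refine Fin.lastCases ?_ (fun i => ?_) i
          · simp; omega
          · simpa using ha i
        · intro i
          refine Fin.lastCases ?_ (fun i => ?_) i
          · simp
          · have := hb i
            simp; omega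
        · intro i j
          refine Fin.lastCases ?_ (fun i => ?_) i <;> refine Fin.lastCases ?_ (fun j => ?_) j
          · simp
          · have := hb j
            simp; omega
          · have := hb i
            simp; omega
          · simp only [Fin.snoc_castSucc]
            intro h
            rw [hc h]
        · intro c hc
          obtain ⟨k, hk, e⟩ := hd c hc
          refine ⟨k, by omega, by omega, ?_⟩
          rw [← e, ← hsn _ k hk (by simp) (by simp)]
          simp
      · intro x hx
        obtain ⟨hl, hl0⟩ := hlast x hx
        ext i
        · refine Fin.lastCases ?_ (fun i => ?_) i
          · simp [hl0]
          · simp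
        · refine Fin.lastCases ?_ (fun i => ?_) i
          · simp [hl]
          · simp
      · intro x hx
        simp
    have hb : ∀ q : Fin m → ℕ, (∀ i, q i ≤ N) → ∀ i, (Fin.snoc q 0 : Fin (m+1) → ℕ) i ≤ N := by
      intro q hq i
      refine Fin.lastCases ?_ (fun i => ?_) i
      · simp
      · simpa using hq i
    have hind := ih (fun q => L (Fin.snoc q 0))
      (fun q hq => by simpa using h1 _ (hb q hq) (Fin.last m) (by simp))
      (fun q hq i hi => by simpa using h1 _ (hb q hq) (Fin.castSucc i) (by simpa using hi))
      (fun q hq i hi => by simpa using h2 _ (hb q hq) (Fin.castSucc i) (by simpa using hi))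
    rw [key, Finset.sum_range_succ, Finset.range_eq_Ico, Finset.sum_eq_sum_Ico_succ_bot (by omega)]
    have hmid : ∑ k ∈ Finset.Ico (0 + 1) (m + 1), ((D k).card : ZMod 2) = 0 :=
      Finset.sum_eq_zero fun k hk => mid k (by rw [Finset.mem_Ico] at hk; rw [Finset.mem_Icc]; omega)
    rw [hmid, add_zero, ← Finset.card_filter_add_card_filter_not
      (s := D (m + 1)) (fun x => ∃ i, x.2 i = m ∧ x.1 i = 0), ← hpos, hzero]
    push_cast
    rw [hind]
    generalize ((D 0).card : ZMod 2) = a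
    revert a
    decide

section CAT0
variable {X : Type} [MetricSpace X]

theorem cat0_mid [CAT0Space X] (y z : X) :
    ∃ m : X, dist y m = dist y z / 2 ∧ dist z m = dist y z / 2 := by
  obtain ⟨γ, h0, h1, h⟩ := CAT0Space.geodesic y z
  refine ⟨γ (1/2), ?_, ?_⟩
  · rw [← h0, h 0 (by norm_num) (1/2) (by norm_num), h0, show |(0:ℝ) - 1/2| = 1/2 by norm_num [abs_of_neg]]
    ring
  · conv_lhs => rw [← h1]
    rw [h 1 (by norm_num) (1/2) (by norm_num), show |(1:ℝ) - 1/2| = 1/2 by norm_num [abs_of_pos]]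
    ring

theorem cn_gen [CAT0Space X] {x y : X} (z : X) {γ : ℝ → X} (hγ : IsGeodesicSeg x y γ)
    {t : ℝ} (ht : t ∈ Set.Icc (0:ℝ) 1) :
    dist z (γ t) ^ 2 ≤ (1 - t) * dist z x ^ 2 + t * dist z y ^ 2 - t * (1 - t) * dist x y ^ 2 := by
  obtain ⟨h0, h1, h⟩ := hγ
  set g : ℝ → ℝ := fun t => dist z (γ t) ^ 2 -
    ((1 - t) * dist z x ^ 2 + t * dist z y ^ 2 - t * (1 - t) * dist x y ^ 2) with hg
  have hγc : ContinuousOn γ (Set.Icc 0 1) := by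
    refine (LipschitzOnWith.of_dist_le_mul (K := nndist x y) ?_).continuousOn
    intro s hs t ht
    rw [h s hs t ht, coe_nndist, Real.dist_eq, mul_comm]
  have hgc : ContinuousOn g (Set.Icc 0 1) := by
    apply ContinuousOn.sub
    · exact ((continuous_const.dist continuous_id).comp_continuousOn hγc).pow 2
    · fun_prop
  obtain ⟨s, hs, hmax⟩ := isCompact_Icc.exists_isMaxOn (Set.nonempty_Icc.2 zero_le_one) hgc
  have hg0 : g 0 = 0 := by simp [hg, h0]
  have hg1 : g 1 = 0 := by simp [hg, h1]
  have hmid : ∀ r, 0 ≤ r → s - r ∈ Set.Icc (0:ℝ) 1 → s + r ∈ Set.Icc (0:ℝ) 1 →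
      g s ≤ (g (s - r) + g (s + r)) / 2 := by
    intro r hr hm hp
    have e1 : dist (γ (s - r)) (γ (s + r)) = 2 * r * dist x y := by
      rw [h _ hm _ hp, show s - r - (s + r) = -(2 * r) by ring, abs_neg, abs_of_nonneg (by linarith)]
    have e2 : dist (γ (s - r)) (γ s) = r * dist x y := by
      rw [h _ hm _ hs, show s - r - s = -r by ring, abs_neg, abs_of_nonneg hr]
    have e3 : dist (γ (s + r)) (γ s) = r * dist x y := by
      rw [h _ hp _ hs, show s + r - s = r by ring, abs_of_nonneg hr]
    have := CAT0Space.cn z (γ (s - r)) (γ (s + r)) (γ s) (by rw [e1, e2]; ring) (by rw [e1, e3]; ring)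
    rw [e1] at this
    simp only [hg]
    nlinarith
  have hs0 : g s ≤ 0 := by
    rcases le_total s (1/2) with hle | hle
    · have h3 := hmid s hs.1 (by constructor <;> linarith [hs.1]) (by constructor <;> linarith [hs.1])
      have h4 : g (s + s) ≤ g s := hmax (by constructor <;> linarith [hs.1])
      rw [sub_self, hg0] at h3
      linarith
    · have h3 := hmid (1 - s) (by linarith [hs.2]) (by constructor <;> linarith [hs.2])
        (by constructor <;> linarith [hs.2])
      have h4 : g (s - (1 - s)) ≤ g s := hmax (by constructor <;> linarith [hs.2])
      rw [add_sub_cancel, hg1] at h3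
      linarith
  have : g t ≤ g s := hmax ht
  simp only [hg] at this hs0
  linarith

/-- Clamping to the unit interval. -/
noncomputable def clampI (t : ℝ) : ℝ := max 0 (min 1 t)

theorem clampI_mem (t : ℝ) : clampI t ∈ Set.Icc (0:ℝ) 1 := by
  unfold clampI
  exact ⟨le_max_left _ _, max_le zero_le_one (min_le_left _ _)⟩

theorem clampI_cont : Continuous clampI := by
  unfold clampI
  fun_prop

/-- A chosen geodesic, extended to all real parameters. -/
noncomputable def geoG [CAT0Space X] (x y : X) (t : ℝ) : X :=
  Classical.choose (CAT0Space.geodesic x y) (clampI t)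

theorem geoG_zero [CAT0Space X] (x y : X) : geoG x y 0 = x := by
  have := (Classical.choose_spec (CAT0Space.geodesic x y)).1
  simpa [geoG, clampI] using this

theorem geoG_one [CAT0Space X] (x y : X) : geoG x y 1 = y := by
  have := (Classical.choose_spec (CAT0Space.geodesic x y)).2.1
  simpa [geoG, clampI] using this

theorem geoG_dist [CAT0Space X] (x y : X) (s t : ℝ) :
    dist (geoG x y s) (geoG x y t) = |clampI s - clampI t| * dist x y :=
  (Classical.choose_spec (CAT0Space.geodesic x y)).2.2 _ (clampI_mem s) _ (clampI_mem t)

theorem geoG_cn [CAT0Space X] (x y z : X) (t : ℝ) :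
    dist z (geoG x y t) ^ 2 ≤ (1 - clampI t) * dist z x ^ 2 + clampI t * dist z y ^ 2
      - clampI t * (1 - clampI t) * dist x y ^ 2 :=
  cn_gen z (Classical.choose_spec (CAT0Space.geodesic x y)) (clampI_mem t)

theorem geoG_dist_left [CAT0Space X] (x y : X) (t : ℝ) :
    dist (geoG x y t) x = clampI t * dist x y := by
  have := geoG_dist x y t 0
  rw [geoG_zero] at this
  rw [this, show clampI 0 = 0 by simp [clampI], sub_zero, abs_of_nonneg (clampI_mem t).1]

theorem geoG_dist_right [CAT0Space X] (x y : X) (t : ℝ) :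
    dist (geoG x y t) y = (1 - clampI t) * dist x y := by
  have := geoG_dist x y t 1
  rw [geoG_one] at this
  rw [this, show clampI 1 = 1 by simp [clampI], abs_sub_comm, abs_of_nonneg (by linarith [(clampI_mem t).2])]

theorem geoG_fix [CAT0Space X] (f : X ≃ᵢ X) {x y : X} (hx : f x = x) (hy : f y = y) (t : ℝ) :
    f (geoG x y t) = geoG x y t := by
  have h := geoG_cn x y (f (geoG x y t)) t
  have e1 : dist (f (geoG x y t)) x = clampI t * dist x y := by
    rw [← geoG_dist_left]
    have := f.dist_eq (geoG x y t) x
    rwa [hx] at this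
  have e2 : dist (f (geoG x y t)) y = (1 - clampI t) * dist x y := by
    rw [← geoG_dist_right]
    have := f.dist_eq (geoG x y t) y
    rwa [hy] at this
  rw [e1, e2] at h
  have : dist (f (geoG x y t)) (geoG x y t) ^ 2 ≤ 0 := by nlinarith
  rw [← dist_eq_zero]
  exact pow_eq_zero_iff (two_ne_zero) |>.1 (le_antisymm this (sq_nonneg _))

theorem geoG_cont [CAT0Space X] : Continuous (fun q : X × X × ℝ => geoG q.1 q.2.1 q.2.2) := by
  rw [continuous_iff_continuousAt]
  rintro ⟨x, y, t⟩
  unfold ContinuousAt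
  rw [tendsto_iff_dist_tendsto_zero]
  set B : X × X × ℝ → ℝ := fun q => (1 - clampI q.2.2) * (clampI q.2.2 * dist q.1 q.2.1 + dist q.1 x) ^ 2 +
    clampI q.2.2 * ((1 - clampI q.2.2) * dist q.1 q.2.1 + dist q.2.1 y) ^ 2 -
      clampI q.2.2 * (1 - clampI q.2.2) * dist x y ^ 2 with hB
  have hBc : Continuous (fun q : X × X × ℝ => Real.sqrt (B q) + |clampI q.2.2 - clampI t| * dist x y) := by
    have h1 : Continuous (fun q : X × X × ℝ => clampI q.2.2) := clampI_cont.comp (by fun_prop)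
    have h2 : Continuous B := by
      rw [hB]
      fun_prop
    fun_prop
  have hB0 : Real.sqrt (B (x, y, t)) + |clampI t - clampI t| * dist x y = 0 := by
    have : B (x, y, t) = 0 := by
      simp only [hB, dist_self]
      ring
    rw [this]; simp
  have hlim := hBc.tendsto (x, y, t)
  simp only [hB0] at hlim
  refine squeeze_zero (fun _ => dist_nonneg) ?_ hlim
  rintro ⟨x', y', t'⟩
  refine (dist_triangle _ (geoG x y t') _).trans ?_
  simp only
  rw [geoG_dist x y t' t]
  gcongr
  apply Real.le_sqrt_of_sq_le
  refine (geoG_cn x y _ t').trans ?_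
  simp only [hB]
  have h1 := (clampI_mem t').1
  have h2 := (clampI_mem t').2
  have e1 : dist (geoG x' y' t') x ≤ clampI t' * dist x' y' + dist x' x := by
    rw [← geoG_dist_left]
    exact dist_triangle _ _ _
  have e2 : dist (geoG x' y' t') y ≤ (1 - clampI t') * dist x' y' + dist y' y := by
    rw [← geoG_dist_right]
    exact dist_triangle _ _ _
  have h3 : 0 ≤ 1 - clampI t' := by linarith
  gcongr

/-- The iterated geodesic cube spanned by `2 ^ n` points. -/
noncomputable def cubeMap [CAT0Space X] : (n : ℕ) → ((Fin n → Bool) → X) → (Fin n → ℝ) → X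
  | 0, p, _ => p Fin.elim0
  | n + 1, p, t => geoG (cubeMap n (fun e => p (Fin.cons false e)) (Fin.tail t))
      (cubeMap n (fun e => p (Fin.cons true e)) (Fin.tail t)) (t 0)

theorem cubeMap_cont [CAT0Space X] (n : ℕ) (p : (Fin n → Bool) → X) : Continuous (cubeMap n p) := by
  induction n with
  | zero => exact continuous_const
  | succ n ih =>
    have ht : Continuous (Fin.tail : (Fin (n+1) → ℝ) → (Fin n → ℝ)) := by
      unfold Fin.tail
      fun_prop
    exact geoG_cont.comp (((ih _).comp ht).prodMk (((ih _).comp ht).prodMk (continuous_apply 0)))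

theorem cubeMap_all [CAT0Space X] (f : X ≃ᵢ X) (n : ℕ) (p : (Fin n → Bool) → X)
    (hp : ∀ e, f (p e) = p e) (t : Fin n → ℝ) : f (cubeMap n p t) = cubeMap n p t := by
  induction n with
  | zero => exact hp _
  | succ n ih => exact geoG_fix f (ih _ (fun e => hp _) _) (ih _ (fun e => hp _) _) _

theorem cubeMap_face [CAT0Space X] (f : X ≃ᵢ X) (n : ℕ) (p : (Fin n → Bool) → X) (i : Fin n) (b : Bool)
    (hp : ∀ e, e i = b → f (p e) = p e) (t : Fin n → ℝ) (ht : t i = if b then 1 else 0) :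
    f (cubeMap n p t) = cubeMap n p t := by
  induction n with
  | zero => exact i.elim0
  | succ n ih =>
    rw [cubeMap]
    revert hp ht
    refine Fin.cases ?_ (fun i => ?_) i
    · intro hp ht
      cases b
      · simp only [Bool.false_eq_true, if_false] at ht
        rw [ht, geoG_zero]
        exact cubeMap_all f n _ (fun e => hp _ (by simp)) _
      · simp only [if_true] at ht
        rw [ht, geoG_one]
        exact cubeMap_all f n _ (fun e => hp _ (by simp)) _
    · intro hp ht
      exact geoG_fix f (ih _ i (fun e he => hp _ (by simpa using he)) _ ht)
        (ih _ i (fun e he => hp _ (by simpa using he)) _ ht) _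

/-- Bruhat–Tits fixed point theorem. -/
theorem bruhat_tits [CAT0Space X] [CompleteSpace X] {G : Type} [Group G] (ρ : G →* (X ≃ᵢ X))
    (x0 : X) (C : ℝ) (hC : ∀ g, dist x0 (ρ g x0) ≤ C) : ∃ x, ∀ g, ρ g x = x := by
  set rad : X → ℝ := fun z => ⨆ g, dist z (ρ g x0) with hrad
  have hbdd : ∀ z, BddAbove (Set.range fun g => dist z (ρ g x0)) := by
    intro z
    refine ⟨dist z x0 + C, ?_⟩
    rintro _ ⟨g, rfl⟩
    exact (dist_triangle _ x0 _).trans (by linarith [hC g])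
  have hle : ∀ z g, dist z (ρ g x0) ≤ rad z := fun z g => le_ciSup (hbdd z) g
  have hnn : ∀ z, 0 ≤ rad z := fun z => dist_nonneg.trans (hle z 1)
  have hbR : BddBelow (Set.range rad) := ⟨0, by rintro _ ⟨z, rfl⟩; exact hnn z⟩
  have : Nonempty X := ⟨x0⟩
  set R := ⨅ z, rad z with hR
  have hRle : ∀ z, R ≤ rad z := fun z => ciInf_le hbR z
  have hR0 : 0 ≤ R := le_ciInf hnn
  have key : ∀ y z r s, rad y ≤ r → rad z ≤ s → dist y z ^ 2 ≤ 2 * r ^ 2 + 2 * s ^ 2 - 4 * R ^ 2 := by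
    intro y z r s hy hz
    obtain ⟨m, h1, h2⟩ := cat0_mid y z
    have hm : rad m ≤ Real.sqrt ((r ^ 2 + s ^ 2) / 2 - dist y z ^ 2 / 4) := by
      apply ciSup_le
      intro g
      apply Real.le_sqrt_of_sq_le
      have h3 := CAT0Space.cn (ρ g x0) y z m h1 h2
      have h4 : dist y (ρ g x0) ^ 2 ≤ r ^ 2 := by
        have := (hle y g).trans hy
        gcongr
      have h5 : dist z (ρ g x0) ^ 2 ≤ s ^ 2 := by
        have := (hle z g).trans hz
        gcongr
      rw [dist_comm m, ]
      rw [dist_comm _ y, dist_comm _ z] at h3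
      linarith
    have hm' := (hRle m).trans hm
    by_cases hneg : 0 ≤ (r ^ 2 + s ^ 2) / 2 - dist y z ^ 2 / 4
    · have := (Real.le_sqrt hR0 hneg).1 hm'
      linarith
    · exfalso
      have h3 := CAT0Space.cn (ρ 1 x0) y z m h1 h2
      have h4 : dist y (ρ 1 x0) ^ 2 ≤ r ^ 2 := by
        have := (hle y 1).trans hy
        gcongr
      have h5 : dist z (ρ 1 x0) ^ 2 ≤ s ^ 2 := by
        have := (hle z 1).trans hz
        gcongr
      rw [dist_comm _ y, dist_comm _ z] at h3
      nlinarith [sq_nonneg (dist (ρ 1 x0) m)]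
  have hex : ∀ k : ℕ, ∃ u, rad u < R + 1 / ((k : ℝ) + 1) := by
    intro k
    apply exists_lt_of_ciInf_lt
    rw [← hR]
    have : (0:ℝ) < 1 / ((k : ℝ) + 1) := by positivity
    linarith
  choose u hu using hex
  have hlim1 : Filter.Tendsto (fun k : ℕ => R + 1 / ((k : ℝ) + 1)) Filter.atTop (nhds R) := by
    simpa using tendsto_const_nhds.add tendsto_one_div_add_atTop_nhds_zero_nat (a := R)
  have hcau : CauchySeq u := by
    refine cauchySeq_of_le_tendsto_0' (fun k : ℕ => Real.sqrt (4 * (R + 1 / ((k : ℝ) + 1)) ^ 2 - 4 * R ^ 2)) ?_ ?_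
    · intro a b hab
      apply Real.le_sqrt_of_sq_le
      have h1 : 1 / ((b : ℝ) + 1) ≤ 1 / ((a : ℝ) + 1) := by gcongr
      have := key (u a) (u b) _ _ (hu a).le ((hu b).le.trans (add_le_add le_rfl h1))
      linarith
    · have : Filter.Tendsto (fun k : ℕ => Real.sqrt (4 * (R + 1 / ((k : ℝ) + 1)) ^ 2 - 4 * R ^ 2))
          Filter.atTop (nhds (Real.sqrt (4 * R ^ 2 - 4 * R ^ 2))) :=
        (((hlim1.pow 2).const_mul 4).sub_const _).sqrt
      simpa using this
  obtain ⟨c, hc⟩ := cauchySeq_tendsto_of_complete hcau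
  have hcd : ∀ g, dist c (ρ g x0) ≤ R := by
    intro g
    exact le_of_tendsto_of_tendsto' (hc.dist tendsto_const_nhds) hlim1
      (fun k => (hle (u k) g).trans (hu k).le)
  refine ⟨c, fun h => ?_⟩
  have h1 : rad c ≤ R := ciSup_le hcd
  have h2 : rad (ρ h c) ≤ R := by
    apply ciSup_le
    intro g
    have : ρ g x0 = ρ h (ρ (h⁻¹ * g) x0) := by
      rw [← IsometryEquiv.mul_apply, ← map_mul]
      simp
    rw [this, (ρ h).dist_eq]
    exact hcd _
  have h3 := key _ _ _ _ h2 h1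
  have : dist (ρ h c) c ^ 2 ≤ 0 := by linarith
  rw [← dist_eq_zero]
  exact pow_eq_zero_iff (two_ne_zero) |>.1 (le_antisymm this (sq_nonneg _))

end CAT0

theorem cover_contra {X : Type} [TopologicalSpace X] (n : ℕ) (A B : Fin n → Set X)
    (hA : ∀ i, IsClosed (A i)) (hB : ∀ i, IsClosed (B i)) (hAB : ∀ i, Disjoint (A i) (B i))
    (F : (Fin n → ℝ) → X) (hF : Continuous F)
    (hFA : ∀ i t, t i = 0 → F t ∈ A i) (hFB : ∀ i t, t i = 1 → F t ∈ B i)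
    (d : ℕ) (hd : d < n) (hX : CoveringDimLE X d) : False := by
  classical
  obtain ⟨κ, V, hVo, hVc, hVU, hVn⟩ := hX (Fin n → Bool)
    (fun e => ⋂ i, (if e i then A i else B i)ᶜ)
    (by
      intro e
      refine isOpen_iInter_of_finite fun i => ?_
      split_ifs
      · exact (hA i).isOpen_compl
      · exact (hB i).isOpen_compl)
    (by
      rw [Set.eq_univ_iff_forall]
      intro x
      rw [Set.mem_iUnion]
      refine ⟨fun i => decide (x ∉ A i), ?_⟩
      rw [Set.mem_iInter]
      intro i
      by_cases h : x ∈ A i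
      · simpa [h] using Set.disjoint_left.1 (hAB i) h
      · simp [h])
  have hopp : ∀ j i s t, s i = 0 → t i = 1 → F s ∈ V j → F t ∈ V j → False := by
    intro j i s t hs ht hsV htV
    obtain ⟨e, he⟩ := hVU j
    have h1 := Set.mem_iInter.1 (he hsV) i
    have h2 := Set.mem_iInter.1 (he htV) i
    have h3 := hFA i s hs
    have h4 := hFB i t ht
    cases h : e i <;> simp [h] at h1 h2 <;> contradiction
  obtain ⟨δ, hδ, hleb⟩ := lebesgue_number_lemma_of_metric
    (s := Set.pi Set.univ fun _ : Fin n => Set.Icc (0:ℝ) 1) (c := fun j => F ⁻¹' V j)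
    (isCompact_univ_pi fun _ => isCompact_Icc) (fun j => (hVo j).preimage hF)
    (by
      intro t _
      have : F t ∈ ⋃ j, V j := by rw [hVc]; trivial
      simpa using this)
  obtain ⟨N, hN⟩ := exists_nat_one_div_lt hδ
  set P : (Fin n → ℕ) → (Fin n → ℝ) := fun q i => (q i : ℝ) / (N + 1 : ℕ) with hP
  have hN0 : (0:ℝ) < (N + 1 : ℕ) := by positivity
  have hball : ∀ q : Fin n → ℕ, ∃ j, (∀ i, q i ≤ N + 1) → Metric.ball (P q) δ ⊆ F ⁻¹' V j := by
    intro q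
    by_cases hq : ∀ i, q i ≤ N + 1
    · obtain ⟨j, hj⟩ := hleb (P q) (by
        intro i _
        refine ⟨by simp only [hP]; positivity, ?_⟩
        simp only [hP]
        rw [div_le_one hN0]
        exact_mod_cast hq i)
      exact ⟨j, fun _ => hj⟩
    · obtain ⟨j, hj⟩ := hleb 0 (by intro i _; simp)
      exact ⟨j, fun h => absurd h hq⟩
  choose J hJ using hball
  have hself : ∀ q, (∀ i, q i ≤ N + 1) → F (P q) ∈ V (J q) := fun q hq =>
    hJ q hq (Metric.mem_ball_self hδ)
  set M : κ → ℕ → Prop := fun j i => n ≤ i ∨ ∃ i' : Fin n, (i' : ℕ) = i ∧ ∃ t, t i' = 0 ∧ F t ∈ V j with hM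
  have hMex : ∀ j, ∃ i, M j i := fun j => ⟨n, Or.inl le_rfl⟩
  set L : κ → ℕ := fun j => Nat.find (hMex j) with hL
  have hsp := sperner_cube n (N + 1) (by omega) (fun q => L (J q))
    (fun q hq => Nat.find_min' _ (Or.inl le_rfl))
    (fun q hq i hi => Nat.find_min' _ (Or.inr ⟨i, rfl, P q, by simp [hP, hi], hself q hq⟩))
    (fun q hq i hi he => by
      have h1 : M (J q) (L (J q)) := Nat.find_spec (hMex (J q))
      rw [he] at h1
      rcases h1 with h1 | ⟨i', hi', t, ht, htV⟩
      · omega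
      · obtain rfl : i' = i := Fin.ext hi'
        refine hopp (J q) i' t (P q) ht ?_ htV (hself q hq)
        simp only [hP, hi]
        exact div_self hN0.ne')
  have hne : Finset.Nonempty {x ∈ kuhnT n (N + 1) | ∀ c ≤ n, ∃ k ≤ n, L (J (kuhnV x k)) = c} := by
    rw [Finset.nonempty_iff_ne_empty]
    intro h
    have h0 : Finset.card {x ∈ kuhnT n (N + 1) | ∀ c ≤ n, ∃ k ≤ n, L (J (kuhnV x k)) = c} = 0 := by
      rw [h]; rfl
    have h1 : (1 : ZMod 2) = 0 := by
      rw [← hsp]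
      convert congrArg (fun a : ℕ => (a : ZMod 2)) h0
      simp
    exact absurd h1 (by decide)
  obtain ⟨x, hx⟩ := hne
  rw [Finset.mem_filter] at hx
  obtain ⟨hxT, hxf⟩ := hx
  have hall : ∀ k, F (P (kuhnV x 0)) ∈ V (J (kuhnV x k)) := by
    intro k
    apply hJ (kuhnV x k) (kuhnV_le hxT k)
    rw [Metric.mem_ball]
    refine lt_of_le_of_lt ?_ hN
    rw [dist_pi_le_iff (by positivity)]
    intro i
    rw [Real.dist_eq]
    simp only [hP, kuhnV, Nat.not_lt_zero, if_false, add_zero]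
    rw [← sub_div, abs_div, abs_of_pos hN0]
    push_cast
    gcongr
    split_ifs <;> simp
  obtain ⟨hfin, hcard⟩ := hVn (F (P (kuhnV x 0)))
  have hsub : Set.Iic n ⊆ L '' {j | F (P (kuhnV x 0)) ∈ V j} := by
    intro c hc
    obtain ⟨k, hk, e⟩ := hxf c hc
    exact ⟨_, hall k, e⟩
  have h1 := Set.ncard_le_ncard hsub (hfin.image L)
  have h2 := Set.ncard_image_le (f := L) hfin
  have h3 : (Set.Iic n).ncard = n + 1 := by
    rw [← Finset.coe_Iic, Set.ncard_coe_finset]; simp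
  omega

section Wreath
open DihedralGroup

/-- Inclusion of the base group. -/
def wl (n : ℕ) : (ZMod n → DihedralGroup 0) →* WreathCd (DihedralGroup 0) n :=
  (SemidirectProduct.inl : _ →* (ZMod n → DihedralGroup 0) ⋊[shiftHom (DihedralGroup 0) n] _)

/-- Inclusion of the top group. -/
def wr (n : ℕ) : Multiplicative (ZMod n) →* WreathCd (DihedralGroup 0) n :=
  (SemidirectProduct.inr : _ →* (ZMod n → DihedralGroup 0) ⋊[shiftHom (DihedralGroup 0) n] _)

theorem wreath_split (n : ℕ) (g : WreathCd (DihedralGroup 0) n) : ∃ f t, g = wl n f * wr n t :=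
  ⟨SemidirectProduct.left g, SemidirectProduct.right g,
    (SemidirectProduct.inl_left_mul_inr_right (φ := shiftHom (DihedralGroup 0) n) g).symm⟩

theorem wreath_conj (n : ℕ) (t : Multiplicative (ZMod n)) (f : ZMod n → DihedralGroup 0) :
    wl n (shiftHom (DihedralGroup 0) n t f) = wr n t * wl n f * wr n t⁻¹ :=
  SemidirectProduct.inl_aut (φ := shiftHom (DihedralGroup 0) n) t f

theorem shift_single (n : ℕ) (i j : ZMod n) (g : DihedralGroup 0) :
    shiftHom (DihedralGroup 0) n (Multiplicative.ofAdd (j - i)) (Pi.mulSingle i g) = Pi.mulSingle j g := by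
  funext s
  change (Pi.mulSingle i g : ZMod n → DihedralGroup 0) (s - (j - i)) = _
  by_cases h : s = j
  · subst h; simp
  · rw [Pi.mulSingle_eq_of_ne h, Pi.mulSingle_eq_of_ne]
    intro h'
    apply h
    linear_combination h'

theorem dihedral_gen (H : Subgroup (DihedralGroup 0)) (h0 : sr 0 ∈ H) (h1 : sr 1 ∈ H)
    (g : DihedralGroup 0) : g ∈ H := by
  have hr : r 1 ∈ H := by
    have := H.mul_mem h0 h1
    rwa [sr_mul_sr, sub_zero] at this
  have hri : ∀ i : ZMod 0, r i ∈ H := by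
    intro i
    have : (r i : DihedralGroup 0) = r 1 ^ (show ℤ from i) := by
      rw [r_zpow]
      congr 1
      rw [one_mul]
      rfl
    rw [this]
    exact H.zpow_mem hr _
  cases g with
  | r i => exact hri i
  | sr i =>
    have := H.mul_mem h0 (hri i)
    rwa [sr_mul_r, zero_add] at this

/-- Points stabilizers. -/
def fixSub {G X : Type} [Group G] [MetricSpace X] (ρ : G →* (X ≃ᵢ X)) (x : X) : Subgroup G where
  carrier := {g | ρ g x = x}
  one_mem' := by simp
  mul_mem' := by
    intro a b ha hb
    simp only [Set.mem_ofPred_eq] at *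
    rw [map_mul, IsometryEquiv.mul_apply, hb, ha]
  inv_mem' := by
    intro a ha
    simp only [Set.mem_ofPred_eq] at *
    conv_lhs => rw [← ha]
    rw [← IsometryEquiv.mul_apply, ← map_mul]
    simp

theorem wreath_fixed (n : ℕ) (hn : 1 ≤ n) (X : Type) [MetricSpace X] [CompleteSpace X] [CAT0Space X]
    [Nonempty X] (ρ : WreathCd (DihedralGroup 0) n →* (X ≃ᵢ X)) (d : ℕ) (hX : CoveringDimLE X d)
    (hd : d < n) : ∃ x : X, ∀ g, ρ g x = x := by
  classical
  have : NeZero n := ⟨by omega⟩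
  let e : Fin n ≃ ZMod n := (ZMod.finEquiv n).toEquiv
  let φ : (ZMod n → DihedralGroup 0) →* (X ≃ᵢ X) := ρ.comp (wl n)
  obtain ⟨x0⟩ := ‹Nonempty X›
  by_cases hfix : ∃ i x, φ (Pi.mulSingle i (sr 0)) x = x ∧ φ (Pi.mulSingle i (sr 1)) x = x
  · obtain ⟨i, x, hx0, hx1⟩ := hfix
    have hi : ∀ g, φ (Pi.mulSingle i g) x = x := fun g =>
      dihedral_gen (fixSub (φ.comp (MonoidHom.mulSingle (fun _ => DihedralGroup 0) i)) x) hx0 hx1 g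
    have hall : ∀ j, ∃ y, ∀ g, φ (Pi.mulSingle j g) y = y := by
      intro j
      refine ⟨ρ (wr n (Multiplicative.ofAdd (j - i))) x, fun g => ?_⟩
      rw [← shift_single n i j g]
      change ρ (wl n _) _ = _
      rw [wreath_conj, ← IsometryEquiv.mul_apply, ← map_mul, mul_assoc, ← map_mul]
      simp only [inv_mul_cancel, map_one, mul_one]
      rw [map_mul, IsometryEquiv.mul_apply]
      congr 1
      exact hi g
    choose y hy using hall
    have hb : ∀ s : Finset (ZMod n), ∀ f : ZMod n → DihedralGroup 0, (∀ i, i ∉ s → f i = 1) →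
        dist x0 (φ f x0) ≤ ∑ j ∈ s, 2 * dist x0 (y j) := by
      intro s
      induction s using Finset.induction_on with
      | empty =>
        intro f hf
        have : f = 1 := funext fun i => hf i (by simp)
        simp [this]
      | insert a s ha ih =>
        intro f hf
        have hsplit : f = Pi.mulSingle a (f a) * Function.update f a 1 := by
          funext j
          by_cases hj : j = a
          · subst hj; simp
          · simp [hj]
        rw [Finset.sum_insert ha, hsplit, map_mul, IsometryEquiv.mul_apply]
        refine (dist_triangle _ (φ (Pi.mulSingle a (f a)) x0) _).trans (add_le_add ?_ ?_)
        · refine (dist_triangle _ (y a) _).trans ?_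
          have := (φ (Pi.mulSingle a (f a))).dist_eq (y a) x0
          rw [hy] at this
          rw [this, dist_comm (y a)]
          linarith
        · rw [(φ (Pi.mulSingle a (f a))).dist_eq]
          apply ih
          intro i his
          by_cases hia : i = a
          · simp [hia]
          · simp only [Function.update_of_ne hia]
            exact hf i (by simp [hia, his])
    obtain ⟨C, hC⟩ := (Set.finite_range fun t => dist x0 (ρ (wr n t) x0)).bddAbove
    refine bruhat_tits ρ x0 ((∑ j ∈ Finset.univ, 2 * dist x0 (y j)) + C) fun g => ?_
    obtain ⟨f, t, rfl⟩ := wreath_split n g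
    rw [map_mul, IsometryEquiv.mul_apply]
    refine (dist_triangle _ (φ f x0) _).trans (add_le_add (hb _ f (by simp)) ?_)
    change dist (ρ (wl n f) x0) _ ≤ _
    rw [(ρ (wl n f)).dist_eq]
    exact hC ⟨t, rfl⟩
  · exfalso
    push Not at hfix
    let c : Bool → DihedralGroup 0 := fun b => sr (if b then 1 else 0)
    have hp : ∀ ε : Fin n → Bool, ∃ x, ∀ k, φ (Pi.mulSingle (e k) (c (ε k))) x = x := by
      intro ε
      let H : Subgroup (ZMod n → DihedralGroup 0) :=
        Subgroup.pi Set.univ fun i => Subgroup.zpowers (c (ε (e.symm i)))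
      have hH : (H : Set (ZMod n → DihedralGroup 0)).Finite := by
        refine (Set.Finite.pi' (t := fun i => (Subgroup.zpowers (c (ε (e.symm i))) : Set (DihedralGroup 0)))
          fun i => ?_).subset ?_
        · rw [finite_zpowers, isOfFinOrder_iff_pow_eq_one]
          exact ⟨2, by norm_num, by simp [c, pow_two]⟩
        · intro f hf i
          exact hf i (Set.mem_univ _)
      have : Finite H := hH
      obtain ⟨C, hC⟩ := (Set.finite_range fun h : H => dist x0 (φ h x0)).bddAbove
      obtain ⟨x, hx⟩ := bruhat_tits (φ.comp H.subtype) x0 C fun h => hC ⟨h, rfl⟩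
      refine ⟨x, fun k => hx ⟨Pi.mulSingle (e k) (c (ε k)), ?_⟩⟩
      intro i _
      by_cases h : i = e k
      · subst h
        simp
      · simp only [Pi.mulSingle_eq_of_ne h]
        exact Subgroup.one_mem _
    choose p hp using hp
    have hcl : ∀ f : X ≃ᵢ X, IsClosed {x | f x = x} := fun f => isClosed_eq f.continuous continuous_id
    refine cover_contra n (fun k => {x | φ (Pi.mulSingle (e k) (c false)) x = x})
      (fun k => {x | φ (Pi.mulSingle (e k) (c true)) x = x}) (fun k => hcl _) (fun k => hcl _)
      (fun k => Set.disjoint_left.2 fun x h0 h1 => hfix (e k) x h0 h1)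
      (cubeMap n p) (cubeMap_cont n p)
      (fun k t ht => cubeMap_face _ n p k false (fun ε he => ?_) t (by simpa using ht))
      (fun k t ht => cubeMap_face _ n p k true (fun ε he => ?_) t (by simpa using ht)) d hd hX
    · rw [← he]; exact hp ε k
    · rw [← he]; exact hp ε k

/-- The action of the infinite dihedral group on the line. -/
noncomputable def dact : DihedralGroup 0 → ℝ → ℝ
  | r i, x => x + ((show ℤ from i : ℤ) : ℝ)
  | sr i, x => - x - ((show ℤ from i : ℤ) : ℝ)

theorem dact_one (x : ℝ) : dact 1 x = x := by
  change x + ((0 : ℤ) : ℝ) = x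
  simp

theorem dact_aux1 (i j : ℤ) (x : ℝ) : x + ((i + j : ℤ) : ℝ) = x + (j : ℝ) + (i : ℝ) := by
  push_cast; ring

theorem dact_aux2 (i j : ℤ) (x : ℝ) : - x - ((j - i : ℤ) : ℝ) = - x - (j : ℝ) + (i : ℝ) := by
  push_cast; ring

theorem dact_aux3 (i j : ℤ) (x : ℝ) : - x - ((i + j : ℤ) : ℝ) = - (x + (j : ℝ)) - (i : ℝ) := by
  push_cast; ring

theorem dact_aux4 (i j : ℤ) (x : ℝ) : x + ((j - i : ℤ) : ℝ) = - (- x - (j : ℝ)) - (i : ℝ) := by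
  push_cast; ring

theorem dact_mul (g h : DihedralGroup 0) (x : ℝ) : dact (g * h) x = dact g (dact h x) := by
  cases g with
  | r i =>
    cases h with
    | r j => exact dact_aux1 i j x
    | sr j => exact dact_aux2 i j x
  | sr i =>
    cases h with
    | r j => exact dact_aux3 i j x
    | sr j => exact dact_aux4 i j x

theorem dact_dist (g : DihedralGroup 0) (x y : ℝ) : dist (dact g x) (dact g y) = dist x y := by
  cases g with
  | r i => simp [dact]
  | sr i => simp [dact]

theorem dact_finite (R : ℝ) : {g : DihedralGroup 0 | ∃ x, |x| ≤ R ∧ |dact g x| ≤ R}.Finite := by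
  obtain ⟨M, hM⟩ := exists_nat_gt (2 * R)
  have hfin : (Set.Icc (-(M:ℤ)) M).Finite := Set.finite_Icc _ _
  refine ((hfin.image fun i : ℤ => (r (show ZMod 0 from i) : DihedralGroup 0)).union
    (hfin.image fun i : ℤ => (sr (show ZMod 0 from i) : DihedralGroup 0))).subset ?_
  rintro g ⟨x, hx, hg⟩
  rw [abs_le] at hx
  cases g with
  | r i =>
    left
    refine ⟨i, ?_, rfl⟩
    change |x + ((show ℤ from i : ℤ) : ℝ)| ≤ R at hg
    rw [abs_le] at hg
    constructor
    · have : (-(M:ℝ)) ≤ ((show ℤ from i : ℤ) : ℝ) := by linarith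
      exact_mod_cast this
    · have : ((show ℤ from i : ℤ) : ℝ) ≤ M := by linarith
      exact_mod_cast this
  | sr i =>
    right
    refine ⟨i, ?_, rfl⟩
    change |- x - ((show ℤ from i : ℤ) : ℝ)| ≤ R at hg
    rw [abs_le] at hg
    constructor
    · have : (-(M:ℝ)) ≤ ((show ℤ from i : ℤ) : ℝ) := by linarith
      exact_mod_cast this
    · have : ((show ℤ from i : ℤ) : ℝ) ≤ M := by linarith
      exact_mod_cast this

/-- Base component. -/
def wleft {n : ℕ} (g : WreathCd (DihedralGroup 0) n) : ZMod n → DihedralGroup 0 :=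
  SemidirectProduct.left g

/-- Top component. -/
def wright {n : ℕ} (g : WreathCd (DihedralGroup 0) n) : ZMod n :=
  Multiplicative.toAdd (SemidirectProduct.right g)

/-- The action of the wreath product on Euclidean space. -/
noncomputable def wact {n : ℕ} (e : Fin n ≃ ZMod n) (g : WreathCd (DihedralGroup 0) n)
    (x : EuclideanSpace ℝ (Fin n)) : EuclideanSpace ℝ (Fin n) :=
  WithLp.toLp 2 fun k => dact (wleft g (e k)) (x (e.symm (e k - wright g)))

theorem wact_one {n : ℕ} (e : Fin n ≃ ZMod n) (x : EuclideanSpace ℝ (Fin n)) : wact e 1 x = x := by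
  ext k
  change dact 1 (x (e.symm (e k - 0))) = x k
  rw [dact_one]; simp

theorem wact_mul {n : ℕ} (e : Fin n ≃ ZMod n) (g h : WreathCd (DihedralGroup 0) n)
    (x : EuclideanSpace ℝ (Fin n)) : wact e (g * h) x = wact e g (wact e h x) := by
  ext k
  change dact (wleft g (e k) * wleft h (e k - wright g)) (x (e.symm (e k - (wright g + wright h)))) =
    dact (wleft g (e k)) (dact (wleft h (e (e.symm (e k - wright g))))
      (x (e.symm (e (e.symm (e k - wright g)) - wright h))))
  rw [dact_mul]
  simp [sub_sub]

theorem wact_isometry {n : ℕ} (e : Fin n ≃ ZMod n) (g : WreathCd (DihedralGroup 0) n) :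
    Isometry (wact e g) := by
  refine Isometry.of_dist_eq fun x y => ?_
  rw [EuclideanSpace.dist_eq, EuclideanSpace.dist_eq]
  congr 1
  have : ∀ k, dist (wact e g x k) (wact e g y k) =
      dist (x (e.symm (e k - wright g))) (y (e.symm (e k - wright g))) := fun k => dact_dist _ _ _
  simp only [this]
  exact Equiv.sum_comp ((e.trans (Equiv.subRight (wright g))).trans e.symm) fun k => dist (x k) (y k) ^ 2

/-- The isometric action as a homomorphism. -/
noncomputable def wHom {n : ℕ} (e : Fin n ≃ ZMod n) : WreathCd (DihedralGroup 0) n →*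
    (EuclideanSpace ℝ (Fin n) ≃ᵢ EuclideanSpace ℝ (Fin n)) where
  toFun g :=
    { toFun := wact e g
      invFun := wact e g⁻¹
      left_inv := fun x => by rw [← wact_mul, inv_mul_cancel, wact_one]
      right_inv := fun x => by rw [← wact_mul, mul_inv_cancel, wact_one]
      isometry_toFun := wact_isometry e g }
  map_one' := by
    ext1 x
    exact wact_one e x
  map_mul' g h := by
    ext1 x
    exact wact_mul e g h x

theorem wreath_proper (n : ℕ) (hn : 1 ≤ n) :
    ∃ ρ : WreathCd (DihedralGroup 0) n →*
        (EuclideanSpace ℝ (Fin n) ≃ᵢ EuclideanSpace ℝ (Fin n)),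
      (∀ K L : Set (EuclideanSpace ℝ (Fin n)), IsCompact K → IsCompact L →
        {g : WreathCd (DihedralGroup 0) n | ((ρ g) '' K ∩ L).Nonempty}.Finite) ∧
      (∃ K : Set (EuclideanSpace ℝ (Fin n)), IsCompact K ∧
        (⋃ g : WreathCd (DihedralGroup 0) n, (ρ g) '' K) = Set.univ) := by
  have : NeZero n := ⟨by omega⟩
  let e : Fin n ≃ ZMod n := (ZMod.finEquiv n).toEquiv
  refine ⟨wHom e, ?_, ?_⟩
  · intro K L hK hL
    obtain ⟨R, hR⟩ := (hK.union hL).isBounded.exists_norm_le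
    have hc : ∀ x ∈ K ∪ L, ∀ k, |x k| ≤ R := fun x hx k =>
      (PiLp.norm_apply_le x k).trans (hR x hx)
    have hfin : (Set.univ.pi fun _ : ZMod n =>
        {g : DihedralGroup 0 | ∃ x, |x| ≤ R ∧ |dact g x| ≤ R}).Finite :=
      Set.Finite.pi fun _ => dact_finite R
    refine (Set.Finite.image2 (fun f t => wl n f * wr n t) hfin
      (Set.finite_univ (α := Multiplicative (ZMod n)))).subset ?_
    rintro g ⟨_, ⟨x, hx, rfl⟩, hgx⟩
    refine ⟨wleft g, ?_, Multiplicative.ofAdd (wright g), Set.mem_univ _,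
      SemidirectProduct.inl_left_mul_inr_right (φ := shiftHom (DihedralGroup 0) n) g⟩
    intro s _
    refine ⟨x (e.symm (s - wright g)), hc x (Or.inl hx) _, ?_⟩
    have := hc _ (Or.inr hgx) (e.symm s)
    change |dact (wleft g (e (e.symm s))) (x (e.symm (e (e.symm s) - wright g)))| ≤ R at this
    rwa [e.apply_symm_apply] at this
  · refine ⟨WithLp.toLp 2 '' (Set.univ.pi fun _ => Set.Icc (0:ℝ) 1),
      (isCompact_univ_pi fun _ => isCompact_Icc).image (PiLp.continuous_toLp 2 _), ?_⟩
    rw [Set.eq_univ_iff_forall]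
    intro x
    rw [Set.mem_iUnion]
    refine ⟨wl n fun s => r (show ZMod 0 from ⌊x (e.symm s)⌋), WithLp.toLp 2 fun k => Int.fract (x k),
      ⟨_, fun k _ => ⟨Int.fract_nonneg _, (Int.fract_lt_one _).le⟩, rfl⟩, ?_⟩
    ext k
    change Int.fract (x (e.symm (e k - 0))) + ((⌊x (e.symm (e k))⌋ : ℤ) : ℝ) = x k
    rw [sub_zero, e.symm_apply_apply]
    exact Int.fract_add_floor _

end Wreath

/-- Taking Γ_n to be the wreath product of the infinite dihedral group with the cyclic group
of order n: Γ_n acts properly and cocompactly by isometries on Euclidean n-space, yet it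
has a global fixed point whenever it acts by isometries on a complete CAT(0) space of
dimension less than n. -/
theorem bieberbach_example (n : ℕ) (hn : 1 ≤ n) :
    (∃ ρ : WreathCd (DihedralGroup 0) n →*
        (EuclideanSpace ℝ (Fin n) ≃ᵢ EuclideanSpace ℝ (Fin n)),
      (∀ K L : Set (EuclideanSpace ℝ (Fin n)), IsCompact K → IsCompact L →
        {g : WreathCd (DihedralGroup 0) n | ((ρ g) '' K ∩ L).Nonempty}.Finite) ∧
      (∃ K : Set (EuclideanSpace ℝ (Fin n)), IsCompact K ∧
        (⋃ g : WreathCd (DihedralGroup 0) n, (ρ g) '' K) = Set.univ)) ∧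
    (∀ (X : Type) [MetricSpace X] [CompleteSpace X] [CAT0Space X] [Nonempty X],
      ∀ ρ : WreathCd (DihedralGroup 0) n →* (X ≃ᵢ X),
      ∀ d : ℕ, CoveringDimLE X d → d < n → ∃ x : X, ∀ g, ρ g x = x) := by
  exact ⟨wreath_proper n hn, fun X _ _ _ _ ρ d hX hd => wreath_fixed n hn X ρ d hX hd⟩
end
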